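/- arXiv:2310.05247 — 2 statements merged into one kernel-verified Lean document; each statement's English description precedes it below -/
import Mathlib

section
/- Let A be an Artin algebra. Then an A-module is Gorenstein-projective if and only if it is Gorenstein-flat; that is, the classes of Gorenstein-projective and Gorenstein-flat A-modules coincide. -/
open CategoryTheory CategoryTheory.Limits

universe u

variable (A : Type u) [Ring A]

/-- The category of cochain complexes of left `A`-modules. -/
abbrev Cplx := CochainComplex (ModuleCat.{u} A) ℤ

/-- A cochain complex is acyclic (exact) if all its cohomology vanishes. -/
def IsAcyclicComplex (X : Cplx A) : Prop := ∀ n : ℤ, X.ExactAt n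

/-- The complex `Hom_A(G, X)` is acyclic. -/
def HomFromAcyclic (G : ModuleCat.{u} A) (X : Cplx A) : Prop :=
  ∀ (n : ℤ) (f : G ⟶ X.X n), f ≫ X.d n (n + 1) = 0 →
    ∃ g : G ⟶ X.X (n - 1), g ≫ X.d (n - 1) n = f

/-- The complex `Hom_A(X, J)` is acyclic. -/
def HomToAcyclic (X : Cplx A) (J : ModuleCat.{u} A) : Prop :=
  ∀ (n : ℤ) (f : X.X n ⟶ J), X.d (n - 1) n ≫ f = 0 →
    ∃ g : X.X (n + 1) ⟶ J, X.d n (n + 1) ≫ g = f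

/-- A Gorenstein-projective module. -/
def IsGorensteinProjective (G : ModuleCat.{u} A) : Prop :=
  ∃ P : Cplx A, IsAcyclicComplex A P ∧ (∀ n : ℤ, Module.Projective A (P.X n)) ∧
    (∀ Q : ModuleCat.{u} A, Module.Projective A Q → HomToAcyclic A P Q) ∧
    Nonempty (G ≅ kernel (P.d 0 1))

/-- A Gorenstein-injective module. -/
def IsGorensteinInjective (J : ModuleCat.{u} A) : Prop :=
  ∃ I : Cplx A, IsAcyclicComplex A I ∧ (∀ n : ℤ, Module.Injective A (I.X n)) ∧
    (∀ E : ModuleCat.{u} A, Module.Injective A E → HomFromAcyclic A E I) ∧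
    Nonempty (J ≅ kernel (I.d 0 1))

/-- A complex `X` is GP-acyclic if `Hom_A(G,X)` is acyclic for every
Gorenstein-projective module `G`. -/
def GPAcyclic (X : Cplx A) : Prop :=
  ∀ G : ModuleCat.{u} A, IsGorensteinProjective A G → HomFromAcyclic A G X

/-- A complex `X` is GI-acyclic if `Hom_A(X,J)` is acyclic for every
Gorenstein-injective module `J`. -/
def GIAcyclic (X : Cplx A) : Prop :=
  ∀ J : ModuleCat.{u} A, IsGorensteinInjective A J → HomToAcyclic A X J

/-- A cochain complex is contractible if its identity is homotopic to zero. -/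
def Contractible (X : Cplx A) : Prop := Nonempty (Homotopy (𝟙 X) 0)

/-- A cochain complex is bounded below if `Xⁿ = 0` for all sufficiently small `n`. -/
def BoundedBelow (X : Cplx A) : Prop := ∃ a : ℤ, ∀ n < a, IsZero (X.X n)

/-- A cochain complex is bounded if `Xⁿ = 0` for all but finitely many `n`. -/
def BoundedComplex (X : Cplx A) : Prop :=
  ∃ a b : ℤ, ∀ n : ℤ, (n < a ∨ b < n) → IsZero (X.X n)

/-- `ProjDimLE n M` means that `M` has projective dimension at most `n`. -/
def ProjDimLE : ℕ → ModuleCat.{u} A → Prop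
  | 0 => fun M => Module.Projective A M
  | n + 1 => fun M => ∃ (K P : ModuleCat.{u} A) (i : K ⟶ P) (p : P ⟶ M),
      Module.Projective A P ∧ Function.Injective i ∧ Function.Surjective p ∧
      Function.Exact i p ∧ ProjDimLE n K

/-- The big finitistic projective dimension of `A` is finite. -/
def FPDFinite : Prop :=
  ∃ s : ℕ, ∀ M : ModuleCat.{u} A, (∃ n : ℕ, ProjDimLE A n M) → ProjDimLE A s M

section BalancedTensor

open TensorProduct

/-- The subgroup of `I ⊗[ℤ] M` spanned by the balancing relations
`x·a ⊗ y - x ⊗ a·y`. -/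
def tensorRel (I : ModuleCat.{u} Aᵐᵒᵖ) (M : ModuleCat.{u} A) :
    Submodule ℤ (TensorProduct ℤ I M) :=
  Submodule.span ℤ
    {z | ∃ (x : I) (a : A) (y : M),
      z = (MulOpposite.op a • x) ⊗ₜ[ℤ] y - x ⊗ₜ[ℤ] (a • y)}

/-- The balanced tensor product `I ⊗[A] M` of a right `A`-module `I` and a left
`A`-module `M`, as a quotient of `I ⊗[ℤ] M` by the balancing relations. -/
def BalancedTensor (I : ModuleCat.{u} Aᵐᵒᵖ) (M : ModuleCat.{u} A) :=
  (TensorProduct ℤ I M) ⧸ tensorRel A I M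

noncomputable instance (I : ModuleCat.{u} Aᵐᵒᵖ) (M : ModuleCat.{u} A) :
    AddCommGroup (BalancedTensor A I M) :=
  Submodule.Quotient.addCommGroup _

/-- The map `id ⊗ f : I ⊗[A] M → I ⊗[A] N` induced on balanced tensor products
by a map `f : M → N` of left modules. -/
noncomputable def balancedMapR (I : ModuleCat.{u} Aᵐᵒᵖ) {M N : ModuleCat.{u} A}
    (f : M ⟶ N) : BalancedTensor A I M →ₗ[ℤ] BalancedTensor A I N :=
  Submodule.mapQ _ _ (LinearMap.lTensor (R := ℤ) I f.hom.toAddMonoidHom.toIntLinearMap)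
    (by
      rw [tensorRel, Submodule.span_le]
      rintro z ⟨x, a, y, rfl⟩
      change LinearMap.lTensor (R := ℤ) I f.hom.toAddMonoidHom.toIntLinearMap
        ((MulOpposite.op a • x) ⊗ₜ[ℤ] y - x ⊗ₜ[ℤ] (a • y)) ∈ tensorRel A I N
      rw [map_sub, LinearMap.lTensor_tmul, LinearMap.lTensor_tmul]
      have hf : f.hom.toAddMonoidHom.toIntLinearMap (a • y) = a • f y := f.hom.map_smul a y
      rw [hf]
      exact Submodule.subset_span ⟨x, a, f y, rfl⟩)

/-- The map `g ⊗ id : I ⊗[A] M → J ⊗[A] M` induced on balanced tensor products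
by a map `g : I → J` of right modules. -/
noncomputable def balancedMapL {I J : ModuleCat.{u} Aᵐᵒᵖ} (g : I ⟶ J)
    (M : ModuleCat.{u} A) : BalancedTensor A I M →ₗ[ℤ] BalancedTensor A J M :=
  Submodule.mapQ _ _ (LinearMap.rTensor (R := ℤ) M g.hom.toAddMonoidHom.toIntLinearMap)
    (by
      rw [tensorRel, Submodule.span_le]
      rintro z ⟨x, a, y, rfl⟩
      change LinearMap.rTensor (R := ℤ) M g.hom.toAddMonoidHom.toIntLinearMap
        ((MulOpposite.op a • x) ⊗ₜ[ℤ] y - x ⊗ₜ[ℤ] (a • y)) ∈ tensorRel A J M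
      rw [map_sub, LinearMap.rTensor_tmul, LinearMap.rTensor_tmul]
      have hg : g.hom.toAddMonoidHom.toIntLinearMap (MulOpposite.op a • x)
          = MulOpposite.op a • g x := g.hom.map_smul (MulOpposite.op a) x
      rw [hg]
      exact Submodule.subset_span ⟨g x, a, y, rfl⟩)

/-- A left `A`-module `M` is flat if `− ⊗[A] M` preserves injectivity of maps of
right `A`-modules. -/
noncomputable def IsFlatModule (M : ModuleCat.{u} A) : Prop :=
  ∀ (I J : ModuleCat.{u} Aᵐᵒᵖ) (g : I ⟶ J), Function.Injective g →
    Function.Injective (balancedMapL A g M)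

/-- The complex `I ⊗[A] F` is acyclic, for `I` a right `A`-module and `F` a
complex of left `A`-modules. -/
noncomputable def TensorAcyclic (I : ModuleCat.{u} Aᵐᵒᵖ) (F : Cplx A) : Prop :=
  ∀ (n : ℤ) (u : BalancedTensor A I (F.X n)),
    balancedMapR A I (F.d n (n + 1)) u = 0 →
      ∃ v : BalancedTensor A I (F.X (n - 1)), balancedMapR A I (F.d (n - 1) n) v = u

/-- A Gorenstein-flat module. -/
noncomputable def IsGorensteinFlat (H : ModuleCat.{u} A) : Prop :=
  ∃ F : Cplx A, IsAcyclicComplex A F ∧ (∀ n : ℤ, IsFlatModule A (F.X n)) ∧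
    (∀ I : ModuleCat.{u} Aᵐᵒᵖ, Module.Injective Aᵐᵒᵖ I → TensorAcyclic A I F) ∧
    Nonempty (H ≅ kernel (F.d 0 1))

end BalancedTensor

section Helpers

variable {A}

/-- the rational circle -/
abbrev QZ := AddCircle (1 : ℚ)

lemma qz_factor {Y Z : Type u} [AddCommGroup Y] [AddCommGroup Z] (g : Y →+ Z) (χ : Y →+ QZ)
    (h : ∀ y, g y = 0 → χ y = 0) : ∃ ψ : Z →+ QZ, ∀ y, ψ (g y) = χ y := by
  let g' : (Y ⧸ g.ker) →+ Z := QuotientAddGroup.kerLift g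
  have hg' : Function.Injective g' := QuotientAddGroup.kerLift_injective g
  let χ' : (Y ⧸ g.ker) →+ QZ := QuotientAddGroup.lift g.ker χ (fun y hy => h y hy)
  obtain ⟨ψ, hψ⟩ := (Module.Baer.of_divisible QZ).extension_property_addMonoidHom g' hg' χ'
  refine ⟨ψ, fun y => ?_⟩
  exact DFunLike.congr_fun hψ (QuotientAddGroup.mk y)

lemma qz_sep {Y : Type u} [AddCommGroup Y] (y : Y) (h : ∀ χ : Y →+ QZ, χ y = 0) : y = 0 :=
  CharacterModule.eq_zero_of_character_apply (A := Y) h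

lemma qz_sep_sub {X Y : Type u} [AddCommGroup X] [AddCommGroup Y] (f : X →+ Y) (y : Y)
    (h : ∀ χ : Y →+ QZ, (∀ x, χ (f x) = 0) → χ y = 0) : ∃ x, f x = y := by
  have : (QuotientAddGroup.mk y : Y ⧸ f.range) = 0 := by
    apply qz_sep
    intro χ
    refine h (χ.comp (QuotientAddGroup.mk' f.range)) (fun x => ?_)
    have : (QuotientAddGroup.mk' f.range) (f x) = 0 := by
      simp
    rw [AddMonoidHom.comp_apply, this, map_zero]
  rw [QuotientAddGroup.eq_zero_iff] at this
  exact this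

/-- character module of a left module -/
def DL (M : Type u) [AddCommGroup M] : Type u := M →+ QZ

/-- character module of a right module -/
def DR (M : Type u) [AddCommGroup M] : Type u := M →+ QZ

noncomputable instance (M : Type u) [AddCommGroup M] : AddCommGroup (DL M) :=
  inferInstanceAs (AddCommGroup (M →+ QZ))

noncomputable instance (M : Type u) [AddCommGroup M] : AddCommGroup (DR M) :=
  inferInstanceAs (AddCommGroup (M →+ QZ))

/-- evaluation -/
def DL.ev {M : Type u} [AddCommGroup M] : DL M →+ (M →+ QZ) := AddMonoidHom.id (M →+ QZ)

/-- evaluation -/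
def DR.ev {M : Type u} [AddCommGroup M] : DR M →+ (M →+ QZ) := AddMonoidHom.id (M →+ QZ)

/-- inverse of evaluation -/
def DL.mk {M : Type u} [AddCommGroup M] : (M →+ QZ) →+ DL M := AddMonoidHom.id (M →+ QZ)

/-- inverse of evaluation -/
def DR.mk {M : Type u} [AddCommGroup M] : (M →+ QZ) →+ DR M := AddMonoidHom.id (M →+ QZ)

@[simp] lemma DL.ev_mk {M : Type u} [AddCommGroup M] (f : M →+ QZ) : DL.ev (DL.mk f) = f := rfl

@[simp] lemma DR.ev_mk {M : Type u} [AddCommGroup M] (f : M →+ QZ) : DR.ev (DR.mk f) = f := rfl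

lemma DL.ext' {M : Type u} [AddCommGroup M] {f g : DL M} (h : ∀ x, DL.ev f x = DL.ev g x) :
    f = g := AddMonoidHom.ext h

lemma DR.ext' {M : Type u} [AddCommGroup M] {f g : DR M} (h : ∀ x, DR.ev f x = DR.ev g x) :
    f = g := AddMonoidHom.ext h

noncomputable instance (M : Type u) [AddCommGroup M] [Module A M] : Module Aᵐᵒᵖ (DL M) where
  smul a f := DL.mk ((DL.ev f).comp (DistribSMul.toAddMonoidHom M a.unop))
  one_smul f := DL.ext' fun x => congrArg (DL.ev f) (one_smul A x)
  mul_smul a b f := DL.ext' fun x => congrArg (DL.ev f) (mul_smul b.unop a.unop x)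
  smul_zero a := DL.ext' fun x => rfl
  smul_add a f g := DL.ext' fun x => rfl
  add_smul a b f := DL.ext' fun x =>
    (congrArg (DL.ev f) (add_smul a.unop b.unop x)).trans ((DL.ev f).map_add _ _)
  zero_smul f := DL.ext' fun x =>
    (congrArg (DL.ev f) (zero_smul A x)).trans ((DL.ev f).map_zero)

@[simp] lemma DL.ev_smul {M : Type u} [AddCommGroup M] [Module A M] (a : Aᵐᵒᵖ) (f : DL M) (x : M) :
    DL.ev (a • f) x = DL.ev f (a.unop • x) := rfl

noncomputable instance (M : Type u) [AddCommGroup M] [Module Aᵐᵒᵖ M] : Module A (DR M) where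
  smul a f := DR.mk ((DR.ev f).comp (DistribSMul.toAddMonoidHom M (MulOpposite.op a)))
  one_smul f := DR.ext' fun x => congrArg (DR.ev f) (one_smul Aᵐᵒᵖ x)
  mul_smul a b f := DR.ext' fun x =>
    congrArg (DR.ev f) (mul_smul (MulOpposite.op b) (MulOpposite.op a) x)
  smul_zero a := DR.ext' fun x => rfl
  smul_add a f g := DR.ext' fun x => rfl
  add_smul a b f := DR.ext' fun x =>
    (congrArg (DR.ev f) (add_smul (MulOpposite.op a) (MulOpposite.op b) x)).trans
      ((DR.ev f).map_add _ _)
  zero_smul f := DR.ext' fun x =>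
    (congrArg (DR.ev f) (zero_smul Aᵐᵒᵖ x)).trans ((DR.ev f).map_zero)

@[simp] lemma DR.ev_smul {M : Type u} [AddCommGroup M] [Module Aᵐᵒᵖ M] (a : A) (f : DR M) (x : M) :
    DR.ev (a • f) x = DR.ev f (MulOpposite.op a • x) := rfl

/-- functoriality -/
noncomputable def DL.map {M N : Type u} [AddCommGroup M] [AddCommGroup N] [Module A M] [Module A N]
    (f : M →ₗ[A] N) : DL N →ₗ[Aᵐᵒᵖ] DL M where
  toFun φ := DL.mk ((DL.ev φ).comp f.toAddMonoidHom)
  map_add' φ ψ := rfl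
  map_smul' a φ := DL.ext' fun x => congrArg (DL.ev φ) (f.map_smul a.unop x).symm

@[simp] lemma DL.ev_map {M N : Type u} [AddCommGroup M] [AddCommGroup N] [Module A M] [Module A N]
    (f : M →ₗ[A] N) (φ : DL N) (x : M) : DL.ev (DL.map f φ) x = DL.ev φ (f x) := rfl

/-- functoriality -/
noncomputable def DR.map {M N : Type u} [AddCommGroup M] [AddCommGroup N] [Module Aᵐᵒᵖ M]
    [Module Aᵐᵒᵖ N] (f : M →ₗ[Aᵐᵒᵖ] N) : DR N →ₗ[A] DR M where
  toFun φ := DR.mk ((DR.ev φ).comp f.toAddMonoidHom)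
  map_add' φ ψ := rfl
  map_smul' a φ := DR.ext' fun x => congrArg (DR.ev φ) (f.map_smul (MulOpposite.op a) x).symm

@[simp] lemma DR.ev_map {M N : Type u} [AddCommGroup M] [AddCommGroup N] [Module Aᵐᵒᵖ M]
    [Module Aᵐᵒᵖ N] (f : M →ₗ[Aᵐᵒᵖ] N) (φ : DR N) (x : M) :
    DR.ev (DR.map f φ) x = DR.ev φ (f x) := rfl

/-- swapping arguments -/
noncomputable def swapLR {M I : Type u} [AddCommGroup M] [AddCommGroup I] [Module A M]
    [Module Aᵐᵒᵖ I] (f : M →ₗ[A] DR I) : I →ₗ[Aᵐᵒᵖ] DL M where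
  toFun x := DL.mk ((DR.ev.comp f.toAddMonoidHom).flip x)
  map_add' x y := DL.ext' fun m => (DR.ev (f m)).map_add x y
  map_smul' a x := DL.ext' fun m => by
    change DR.ev (f m) (a • x) = DR.ev (f (a.unop • m)) x
    rw [f.map_smul, DR.ev_smul, MulOpposite.op_unop]

@[simp] lemma ev_swapLR {M I : Type u} [AddCommGroup M] [AddCommGroup I] [Module A M]
    [Module Aᵐᵒᵖ I] (f : M →ₗ[A] DR I) (x : I) (m : M) :
    DL.ev (swapLR f x) m = DR.ev (f m) x := rfl

/-- swapping arguments -/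
noncomputable def swapRL {M I : Type u} [AddCommGroup M] [AddCommGroup I] [Module A M]
    [Module Aᵐᵒᵖ I] (f : I →ₗ[Aᵐᵒᵖ] DL M) : M →ₗ[A] DR I where
  toFun x := DR.mk ((DL.ev.comp f.toAddMonoidHom).flip x)
  map_add' x y := DR.ext' fun m => (DL.ev (f m)).map_add x y
  map_smul' a x := DR.ext' fun m => by
    change DL.ev (f m) (a • x) = DL.ev (f (MulOpposite.op a • m)) x
    rw [f.map_smul, DL.ev_smul, MulOpposite.unop_op]

@[simp] lemma ev_swapRL {M I : Type u} [AddCommGroup M] [AddCommGroup I] [Module A M]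
    [Module Aᵐᵒᵖ I] (f : I →ₗ[Aᵐᵒᵖ] DL M) (x : I) (m : M) :
    DR.ev (swapRL f m) x = DL.ev (f x) m := rfl

lemma DL_injective_of_projective (P : Type u) [AddCommGroup P] [Module A P]
    [Module.Projective A P] : Module.Injective Aᵐᵒᵖ (DL P) where
  out X Y _ _ _ _ i hi g := by
    have hs : Function.Surjective (DR.map i : DR Y →ₗ[A] DR X) := by
      intro φ
      obtain ⟨ψ, hψ⟩ := qz_factor i.toAddMonoidHom (DR.ev φ) (fun y hy => by
        have : y = 0 := hi (by rw [map_zero]; exact hy)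
        simp [this])
      exact ⟨DR.mk ψ, DR.ext' hψ⟩
    obtain ⟨h, hh⟩ := Module.projective_lifting_property (DR.map i) (swapRL g) hs
    refine ⟨swapLR h, fun x => DL.ext' fun m => ?_⟩
    have := congrArg (fun q => DR.ev q x) (LinearMap.congr_fun hh m)
    exact this

/-- Key step of the Bass theorem. -/
lemma split_aux [IsSemiprimaryRing A] {X F : Type u} [AddCommGroup X] [AddCommGroup F]
    [Module A X] [Module A F] (hF : Module.Injective Aᵐᵒᵖ (DL F)) (π : X →ₗ[A] F)
    (hπ : Function.Surjective π)
    (hJ : ∀ j ∈ Ring.jacobson A, ∀ n, π n = 0 → j • n = 0) :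
    ∃ s : F →ₗ[A] X, π ∘ₗ s = LinearMap.id := by
  obtain ⟨ρ, hρ⟩ := hF.out (DL.map π) (fun φ ψ h => DL.ext' fun y => by
    obtain ⟨x, rfl⟩ := hπ y
    exact congrArg (fun q => DL.ev q x) h) LinearMap.id
  have key : ∀ n, π n = 0 → n ∈ Ring.jacobson A • (⊤ : Submodule A X) → n = 0 := by
    intro n hn hnJ
    apply qz_sep
    intro χ
    let χ' : DL X := DL.mk χ
    let ψ : DL X := χ' - DL.map π (ρ χ')
    have h1 : ∀ j ∈ Ring.jacobson A, (MulOpposite.op j) • ψ = 0 := by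
      intro j hj
      obtain ⟨φ, hφ⟩ := qz_factor π.toAddMonoidHom (DL.ev (MulOpposite.op j • χ'))
        (fun y hy => by
          rw [DL.ev_smul, MulOpposite.unop_op, hJ j hj y hy, map_zero])
      have h2 : DL.map π (DL.mk φ) = MulOpposite.op j • χ' := DL.ext' hφ
      have h3 := hρ (DL.mk φ)
      rw [h2] at h3
      simp only [ψ, smul_sub, ← map_smul, h3]
      rw [LinearMap.id_apply, h2, sub_self]
    have h4 : DL.ev ψ n = 0 := by
      refine Submodule.smul_induction_on (p := fun n => DL.ev ψ n = 0) hnJ ?_ ?_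
      · intro j hj x _
        have := congrArg (fun q => DL.ev q x) (h1 j hj)
        simpa using this
      · intro x y hx hy
        rw [map_add, hx, hy, add_zero]
    have h5 : DL.ev ψ n = χ n - DL.ev (ρ χ') (π n) := rfl
    rw [h4, hn, map_zero, sub_zero] at h5
    exact h5.symm
  let JX := Ring.jacobson A • (⊤ : Submodule A X)
  have hss : IsSemisimpleModule A (X ⧸ JX) := by
    have h : Module.IsTorsionBySet A (X ⧸ JX) (Ring.jacobson A) := by
      rw [Module.isTorsionBySet_quotient_iff]
      exact fun m i hi ↦ Submodule.smul_mem_smul hi trivial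
    let _ := h.module
    exact (h.semilinearMap.isSemisimpleModule_iff_of_bijective Function.bijective_id).2
      inferInstance
  obtain ⟨C', hC'⟩ := exists_isCompl (Submodule.map JX.mkQ (LinearMap.ker π))
  let C := C'.comap JX.mkQ
  have hb : Function.Bijective (π.domRestrict C) := by
    constructor
    · rw [injective_iff_map_eq_zero]
      rintro ⟨c, hc⟩ h
      have hc0 : π c = 0 := h
      have : JX.mkQ c = 0 := by
        have := hC'.disjoint.le_bot ⟨Submodule.mem_map_of_mem (f := JX.mkQ) (show c ∈ LinearMap.ker π from hc0), hc⟩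
        simpa using this
      have h2 : c ∈ JX := by simpa using this
      exact Subtype.ext (key c hc0 h2)
    · intro y
      obtain ⟨x, rfl⟩ := hπ y
      have : JX.mkQ x ∈ Submodule.map JX.mkQ (LinearMap.ker π) ⊔ C' := by
        rw [hC'.sup_eq_top]; trivial
      obtain ⟨a, ⟨n, hn, rfl⟩, c, hc, hac⟩ := Submodule.mem_sup.1 this
      refine ⟨⟨x - n, ?_⟩, ?_⟩
      · change JX.mkQ (x - n) ∈ C'
        rw [map_sub, ← hac, add_sub_cancel_left]
        exact hc
      · change π (x - n) = π x
        rw [map_sub, show π n = 0 from hn, sub_zero]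
  let e := LinearEquiv.ofBijective (π.domRestrict C) hb
  refine ⟨C.subtype ∘ₗ e.symm.toLinearMap, LinearMap.ext fun y => ?_⟩
  exact e.apply_symm_apply y

lemma split_pow [IsSemiprimaryRing A] {F : Type u} [AddCommGroup F]
    [Module A F] (hF : Module.Injective Aᵐᵒᵖ (DL F)) (n : ℕ) :
    ∀ {X : Type u} [AddCommGroup X] [Module A X] (π : X →ₗ[A] F)
    (_ : Function.Surjective π)
    (_ : (Ring.jacobson A) ^ n • LinearMap.ker π = ⊥),
    ∃ s : F →ₗ[A] X, π ∘ₗ s = LinearMap.id := by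
  induction n with
  | zero =>
    intro X _ _ π hπ hJ
    rw [Submodule.pow_zero, Submodule.one_smul] at hJ
    let e := LinearEquiv.ofBijective π ⟨LinearMap.ker_eq_bot.1 hJ, hπ⟩
    exact ⟨e.symm.toLinearMap, LinearMap.ext fun y => e.apply_symm_apply y⟩
  | succ n ih =>
    intro X _ _ π hπ hJ
    let JN := Ring.jacobson A • LinearMap.ker π
    have hJN : JN ≤ LinearMap.ker π := Submodule.smul_le_right
    let πb : (X ⧸ JN) →ₗ[A] F := JN.liftQ π hJN
    obtain ⟨s, hs⟩ := split_aux hF πb (fun y => by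
      obtain ⟨x, rfl⟩ := hπ y
      exact ⟨JN.mkQ x, rfl⟩) (by
      intro j hj m hm
      obtain ⟨x, rfl⟩ := JN.mkQ_surjective m
      rw [← map_smul]
      have : j • x ∈ JN := Submodule.smul_mem_smul hj hm
      exact (Submodule.Quotient.mk_eq_zero JN).2 this)
    let X' := (LinearMap.range s).comap JN.mkQ
    have hker : ∀ x : X', π x = 0 → (x : X) ∈ JN := by
      rintro ⟨x, ⟨y, hy⟩⟩ hx
      have h1 : πb (s y) = y := LinearMap.congr_fun hs y
      have h2 : πb (JN.mkQ x) = 0 := hx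
      rw [← hy, h1] at h2
      rw [h2, map_zero] at hy
      simpa using hy.symm
    obtain ⟨t, ht⟩ := ih (π.domRestrict X') (fun y => by
      obtain ⟨x, hx⟩ := JN.mkQ_surjective (s y)
      refine ⟨⟨x, ⟨y, hx.symm⟩⟩, ?_⟩
      change πb (JN.mkQ x) = y
      rw [hx]
      exact LinearMap.congr_fun hs y) (by
      rw [eq_bot_iff, Submodule.smul_le]
      rintro r hr x hx
      have h1 := hker x hx
      have h2 : r • (x : X) ∈ (Ring.jacobson A) ^ n • JN := Submodule.smul_mem_smul hr h1
      rw [← Submodule.mul_smul, ← Submodule.pow_succ, hJ] at h2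
      exact Subtype.ext h2)
    exact ⟨X'.subtype ∘ₗ t, LinearMap.ext fun y => LinearMap.congr_fun ht y⟩

lemma projective_of_DL_injective [IsSemiprimaryRing A] (F : Type u) [AddCommGroup F]
    [Module A F] (hF : Module.Injective Aᵐᵒᵖ (DL F)) : Module.Projective A F := by
  obtain ⟨n, hn⟩ := IsSemiprimaryRing.isNilpotent (R := A)
  refine Module.Projective.of_lifting_property'' (fun f hf => ?_)
  refine split_pow hF n f hf ?_
  rw [hn]
  exact Submodule.bot_smul _

lemma DLDR_injective [IsNoetherianRing Aᵐᵒᵖ] (I : Type u) [AddCommGroup I] [Module Aᵐᵒᵖ I]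
    (hI : Module.Injective Aᵐᵒᵖ I) : Module.Injective Aᵐᵒᵖ (DL (DR (I))) := by
  apply Module.Baer.injective
  intro J f
  obtain ⟨n, x, hx⟩ := Module.Finite.exists_fin' Aᵐᵒᵖ J
  obtain ⟨m, r, hr⟩ := Module.Finite.exists_fin' Aᵐᵒᵖ (LinearMap.ker x)
  -- basis images
  let xi : Fin n → J := fun i => x (Pi.single i 1)
  let rj : Fin m → (Fin n → Aᵐᵒᵖ) := fun j => (r (Pi.single j 1) : Fin n → Aᵐᵒᵖ)
  have x_apply : ∀ v, x v = ∑ i, v i • xi i := fun v => by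
    conv_lhs => rw [pi_eq_sum_univ' v, map_sum]
    refine Finset.sum_congr rfl fun i _ => ?_
    rw [map_smul]
  have r_apply : ∀ w, (r w : Fin n → Aᵐᵒᵖ) = ∑ j, w j • rj j := fun w => by
    conv_lhs => rw [pi_eq_sum_univ' w, map_sum, Submodule.coe_sum]
    refine Finset.sum_congr rfl fun i _ => ?_
    rw [map_smul, Submodule.coe_smul]
  have rel : ∀ j, ∑ i, rj j i • xi i = 0 := fun j => by
    rw [← x_apply]; exact (r (Pi.single j 1)).2
  let δ : I →+ (Fin n → I) := AddMonoidHom.mk' (fun z i => (xi i : Aᵐᵒᵖ) • z)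
    (fun a b => by funext i; exact smul_add _ _ _)
  let ρ : (Fin n → I) →+ (Fin m → I) := AddMonoidHom.mk' (fun y j => ∑ i, rj j i • y i)
    (fun a b => by funext j; simp [smul_add, Finset.sum_add_distrib])
  have ex : ∀ y, ρ y = 0 → ∃ z, δ z = y := by
    intro y hy
    let g : (Fin n → Aᵐᵒᵖ) →ₗ[Aᵐᵒᵖ] I := Fintype.linearCombination Aᵐᵒᵖ y
    have hg : ∀ v, g v = ∑ i, v i • y i := fun v => Fintype.linearCombination_apply _ _ v
    have hk : LinearMap.ker x ≤ LinearMap.ker g := by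
      intro v hv
      obtain ⟨w, hw⟩ := hr ⟨v, hv⟩
      have hv' : v = ∑ j, w j • rj j := by rw [← r_apply, hw]
      rw [LinearMap.mem_ker, hv', map_sum]
      apply Finset.sum_eq_zero
      intro j _
      rw [map_smul, hg, show ∑ i, rj j i • y i = 0 from congrFun hy j, smul_zero]
    let e := x.quotKerEquivOfSurjective hx
    let g' : J →ₗ[Aᵐᵒᵖ] I := ((LinearMap.ker x).liftQ g hk) ∘ₗ e.symm.toLinearMap
    have hg' : ∀ v, g' (x v) = g v := fun v => by
      have : e.symm (x v) = (LinearMap.ker x).mkQ v := by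
        rw [LinearEquiv.symm_apply_eq]; rfl
      change (LinearMap.ker x).liftQ g hk (e.symm (x v)) = g v
      rw [this]; rfl
    obtain ⟨h, hh⟩ := Module.Baer.of_injective hI J g'
    refine ⟨h 1, ?_⟩
    funext i
    change (xi i : Aᵐᵒᵖ) • h 1 = y i
    rw [← map_smul, smul_eq_mul, mul_one, hh _ (xi i).2]
    change g' (x (Pi.single i 1)) = y i
    rw [hg', hg]
    simp [Pi.single_apply]
  -- the element of the double dual of `I ^ n`
  let y : Fin n → DL (DR I) := fun i => f (xi i)
  let Y : ((Fin n → I) →+ QZ) →+ QZ := AddMonoidHom.mk'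
    (fun ψ => ∑ i, DL.ev (y i) (DR.mk (ψ.comp (AddMonoidHom.single (fun _ => I) i))))
    (fun a b => by
      simp only [AddMonoidHom.add_comp, map_add, Finset.sum_add_distrib])
  let δ' : ((Fin n → I) →+ QZ) →+ (I →+ QZ) := AddMonoidHom.mk' (fun ψ => ψ.comp δ)
    (fun a b => AddMonoidHom.add_comp _ _ _)
  obtain ⟨z, hz⟩ := qz_factor δ' Y (by
    intro ψ hψ
    obtain ⟨θ, hθ⟩ := qz_factor ρ ψ (by
      intro v hv
      obtain ⟨z, rfl⟩ := ex v hv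
      exact DFunLike.congr_fun hψ z)
    let θj : Fin m → DR I := fun j => DR.mk (θ.comp (AddMonoidHom.single (fun _ => I) j))
    have h1 : ∀ i, DR.mk (ψ.comp (AddMonoidHom.single (fun _ => I) i)) =
        ∑ j, (rj j i).unop • θj j := by
      intro i
      apply DR.ext'
      intro c
      rw [map_sum, AddMonoidHom.finsetSum_apply]
      change ψ (Pi.single i c) = ∑ j, θ (Pi.single j (rj j i • c))
      rw [← hθ, ← map_sum]
      congr 1
      funext j
      rw [Finset.sum_apply]
      change ∑ i', rj j i' • (Pi.single i c : Fin n → I) i' = _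
      simp [Pi.single_apply]
    change ∑ i, DL.ev (y i) (DR.mk (ψ.comp (AddMonoidHom.single (fun _ => I) i))) = 0
    simp only [h1, map_sum]
    rw [Finset.sum_comm]
    apply Finset.sum_eq_zero
    intro j _
    have h2 : ∑ i, rj j i • y i = 0 := by
      simp only [y, ← map_smul, ← map_sum, rel, map_zero]
    have h3 := congrArg (fun q => DL.ev q (θj j)) h2
    simpa [map_sum, AddMonoidHom.finsetSum_apply] using h3)
  let z' : DL (DR I) := DL.mk (M := DR I) z
  have hzi : ∀ i, (xi i : Aᵐᵒᵖ) • z' = y i := by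
    intro i
    apply DL.ext'
    intro φ
    have h1 := hz ((DR.ev φ).comp (Pi.evalAddMonoidHom (fun _ => I) i))
    have h2 : δ' ((DR.ev φ).comp (Pi.evalAddMonoidHom (fun _ => I) i)) =
        DR.ev ((xi i : Aᵐᵒᵖ).unop • φ) := rfl
    rw [h2] at h1
    refine Eq.trans h1 ?_
    change ∑ i', DL.ev (y i') _ = _
    rw [Finset.sum_eq_single i]
    · congr 1
      apply DR.ext'
      intro c
      simp
    · intro i' _ hne
      convert map_zero (DL.ev (y i')) using 2
      apply DR.ext'
      intro c
      simp [hne.symm]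
    · simp
  refine ⟨LinearMap.toSpanSingleton Aᵐᵒᵖ _ z', ?_⟩
  intro b hb
  obtain ⟨v, hv⟩ := hx ⟨b, hb⟩
  rw [← hv, x_apply, map_sum]
  have : b = ∑ i, v i • (xi i : Aᵐᵒᵖ) := by
    have := congrArg Subtype.val hv
    rw [x_apply] at this
    simpa using this.symm
  rw [LinearMap.toSpanSingleton_apply, this, Finset.sum_smul]
  refine Finset.sum_congr rfl fun i _ => ?_
  rw [smul_assoc, hzi, map_smul]

/-- biduality map -/
noncomputable def eta (Q : Type u) [AddCommGroup Q] [Module A Q] : Q →ₗ[A] DR (DL Q) :=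
  swapRL LinearMap.id

lemma eta_split [IsNoetherianRing Aᵐᵒᵖ] [IsSemiprimaryRing A] (Q : Type u) [AddCommGroup Q]
    [Module A Q] [Module.Projective A Q] :
    ∃ s : DR (DL Q) →ₗ[A] Q, s ∘ₗ eta Q = LinearMap.id := by
  have h1 := DL_injective_of_projective (A := A) Q
  have h3 := DLDR_injective (DL Q) h1
  let R := LinearMap.range (eta (A := A) Q)
  have hC : Module.Injective Aᵐᵒᵖ (DL (DR (DL Q) ⧸ R)) := by
    constructor
    intro X Y _ _ _ _ i hi g
    obtain ⟨h, hh⟩ := h3.out i hi (DL.map R.mkQ ∘ₗ g)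
    let h' : Y →ₗ[Aᵐᵒᵖ] DL (DR (DL Q)) := h - swapLR LinearMap.id ∘ₗ DL.map (eta Q) ∘ₗ h
    have hR : R ≤ LinearMap.ker (swapRL h') := by
      rintro _ ⟨q, rfl⟩
      apply DR.ext'
      intro y
      change DL.ev (h y) (eta (A := A) Q q) - DL.ev (h y) (eta (A := A) Q q) = 0
      exact sub_self _
    refine ⟨swapLR (R.liftQ (swapRL h') hR), fun x => DL.ext' fun c => ?_⟩
    obtain ⟨w, rfl⟩ := R.mkQ_surjective c
    change DL.ev (h (i x)) w - DR.ev w (DL.map (eta Q) (h (i x))) = _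
    rw [hh]
    have : DL.map (eta (A := A) Q) ((DL.map R.mkQ ∘ₗ g) x) = 0 := by
      apply DL.ext'
      intro q
      change DL.ev (g x) (R.mkQ (eta (A := A) Q q)) = 0
      have : R.mkQ (eta (A := A) Q q) = 0 := (Submodule.Quotient.mk_eq_zero R).2 ⟨q, rfl⟩
      rw [this, map_zero]
    rw [this, map_zero, sub_zero]
    rfl
  have := projective_of_DL_injective _ hC
  obtain ⟨t, ht⟩ := Module.projective_lifting_property R.mkQ LinearMap.id R.mkQ_surjective
  have hinj : Function.Injective (eta (A := A) Q) := by
    rw [injective_iff_map_eq_zero]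
    intro q hq
    apply qz_sep
    intro χ
    exact congrArg (fun w => DR.ev w (DL.mk χ)) hq
  let e := LinearEquiv.ofInjective (eta (A := A) Q) hinj
  let p : DR (DL Q) →ₗ[A] R := LinearMap.codRestrict R (LinearMap.id - t ∘ₗ R.mkQ) (by
    intro w
    refine (Submodule.Quotient.mk_eq_zero R).1 ?_
    change R.mkQ (w - t (R.mkQ w)) = 0
    rw [map_sub, sub_eq_zero]
    exact (LinearMap.congr_fun ht (R.mkQ w)).symm)
  refine ⟨e.symm.toLinearMap ∘ₗ p, LinearMap.ext fun q => ?_⟩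
  change e.symm (p (eta (A := A) Q q)) = q
  rw [LinearEquiv.symm_apply_eq]
  apply Subtype.ext
  change eta Q q - t (R.mkQ (eta (A := A) Q q)) = eta Q q
  have : R.mkQ (eta (A := A) Q q) = 0 := (Submodule.Quotient.mk_eq_zero R).2 ⟨q, rfl⟩
  rw [this, map_zero, sub_zero]

open TensorProduct in
/-- pure tensors -/
noncomputable def btmul (I : ModuleCat.{u} Aᵐᵒᵖ) (M : ModuleCat.{u} A) (x : I) (y : M) :
    BalancedTensor A I M := Submodule.Quotient.mk (p := tensorRel A I M) (x ⊗ₜ[ℤ] y)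

lemma bt_ext {I : ModuleCat.{u} Aᵐᵒᵖ} {M : ModuleCat.{u} A} {f g : BalancedTensor A I M →+ QZ}
    (h : ∀ x y, f (btmul I M x y) = g (btmul I M x y)) (u : BalancedTensor A I M) :
    f u = g u := by
  obtain ⟨t, rfl⟩ := Submodule.Quotient.mk_surjective (tensorRel A I M) u
  induction t using TensorProduct.induction_on with
  | zero => exact (map_zero f).trans (map_zero g).symm
  | tmul x y => exact h x y
  | add s t hs ht =>
    exact (map_add f _ _).trans ((congrArg₂ (· + ·) hs ht).trans (map_add g _ _).symm)

lemma bt_mapR {I : ModuleCat.{u} Aᵐᵒᵖ} {M N : ModuleCat.{u} A} (f : M ⟶ N) (x : I) (y : M) :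
    balancedMapR A I f (btmul I M x y) = btmul I N x (f y) := rfl

lemma bt_mapL {I J : ModuleCat.{u} Aᵐᵒᵖ} {M : ModuleCat.{u} A} (f : I ⟶ J) (x : I) (y : M) :
    balancedMapL A f M (btmul I M x y) = btmul J M (f x) y := rfl

open TensorProduct in
/-- the character of the tensor product given by a linear map -/
lemma bt_lift {I : ModuleCat.{u} Aᵐᵒᵖ} {M : ModuleCat.{u} A} (f : I →ₗ[Aᵐᵒᵖ] DL M) :
    ∃ h : BalancedTensor A I M →+ QZ, ∀ x y, h (btmul I M x y) = DL.ev (f x) y := by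
  let t : TensorProduct ℤ I M →+ QZ := TensorProduct.liftAddHom (DL.ev.comp f.toAddMonoidHom)
    (fun r m n => by
      change DL.ev (f (r • m)) n = DL.ev (f m) (r • n)
      rw [map_zsmul, map_zsmul, map_zsmul]; rfl)
  let h : (TensorProduct ℤ I M ⧸ tensorRel A I M) →ₗ[ℤ] QZ :=
    (tensorRel A I M).liftQ t.toIntLinearMap (by
    rw [tensorRel, Submodule.span_le]
    rintro z ⟨x, a, y, rfl⟩
    change t ((MulOpposite.op a • x) ⊗ₜ[ℤ] y - x ⊗ₜ[ℤ] (a • y)) = 0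
    rw [map_sub, sub_eq_zero]
    change DL.ev (f (MulOpposite.op a • x)) y = DL.ev (f x) (a • y)
    rw [map_smul]; rfl)
  exact ⟨h.toAddMonoidHom, fun x y => rfl⟩

open TensorProduct in
/-- the linear map given by a character of the tensor product -/
lemma bt_curry {I : ModuleCat.{u} Aᵐᵒᵖ} {M : ModuleCat.{u} A} (h : BalancedTensor A I M →+ QZ) :
    ∃ f : I →ₗ[Aᵐᵒᵖ] DL M, ∀ x y, DL.ev (f x) y = h (btmul I M x y) := by
  have addl : ∀ x x' y, btmul I M (x + x') y = btmul I M x y + btmul I M x' y := fun x x' y =>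
    congrArg (Submodule.Quotient.mk (p := tensorRel A I M)) (TensorProduct.add_tmul x x' y)
  have addr : ∀ x y y', btmul I M x (y + y') = btmul I M x y + btmul I M x y' := fun x y y' =>
    congrArg (Submodule.Quotient.mk (p := tensorRel A I M)) (TensorProduct.tmul_add x y y')
  have bal : ∀ (a : A) x y, btmul I M (MulOpposite.op a • x) y = btmul I M x (a • y) :=
    fun a x y => (Submodule.Quotient.eq _).2 (Submodule.subset_span ⟨x, a, y, rfl⟩)
  refine ⟨{ toFun := fun x => DL.mk (AddMonoidHom.mk' (fun y => h (btmul I M x y))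
              (fun y y' => by rw [addr, map_add]))
            map_add' := fun x x' => DL.ext' fun y => ?_
            map_smul' := fun a x => DL.ext' fun y => ?_ }, fun x y => rfl⟩
  · change h (btmul I M (x + x') y) = h (btmul I M x y) + h (btmul I M x' y)
    rw [addl, map_add]
  · change h (btmul I M (a • x) y) = h (btmul I M x (a.unop • y))
    rw [← bal, MulOpposite.op_unop]

lemma flat_iff (M : ModuleCat.{u} A) : IsFlatModule A M ↔ Module.Injective Aᵐᵒᵖ (DL M) := by
  constructor
  · intro H
    constructor
    intro X Y _ _ _ _ i hi g
    have hinj := H (ModuleCat.of Aᵐᵒᵖ X) (ModuleCat.of Aᵐᵒᵖ Y) (ModuleCat.ofHom i) hi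
    obtain ⟨h, hh⟩ := bt_lift (I := ModuleCat.of Aᵐᵒᵖ X) (M := M) g
    obtain ⟨ψ, hψ⟩ := qz_factor
      (balancedMapL A (ModuleCat.ofHom i) M).toAddMonoidHom h (fun y hy => by
        have : y = 0 := hinj (by rw [map_zero]; exact hy)
        rw [this, map_zero])
    obtain ⟨f, hf⟩ := bt_curry ψ
    refine ⟨f, fun x => DL.ext' fun y => ?_⟩
    refine (hf (i x) y).trans (Eq.trans ?_ (hh x y))
    exact hψ (btmul (ModuleCat.of Aᵐᵒᵖ X) M x y)
  · intro H I J g hg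
    rw [injective_iff_map_eq_zero]
    intro z hz
    apply qz_sep
    intro χ
    obtain ⟨f, hf⟩ := bt_curry χ
    obtain ⟨f', hf'⟩ := H.out g.hom hg f
    obtain ⟨h, hh⟩ := bt_lift f'
    have : χ z = (h.comp (balancedMapL A g M).toAddMonoidHom) z := by
      apply bt_ext
      intro x y
      rw [← hf, ← hf']
      exact (hh (g x) y).symm
    rw [this]
    change h (balancedMapL A g M z) = 0
    rw [hz, map_zero]

lemma tensorAcyclic_iff (I : ModuleCat.{u} Aᵐᵒᵖ) (F : Cplx A) :
    TensorAcyclic A I F ↔ HomToAcyclic A F (ModuleCat.of A (DR I)) := by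
  constructor
  · intro H n f hf
    obtain ⟨h, hh⟩ := bt_lift (swapLR f.hom)
    obtain ⟨ψ, hψ⟩ := qz_factor (balancedMapR A I (F.d n (n + 1))).toAddMonoidHom h (by
      intro u hu
      obtain ⟨v, rfl⟩ := H n u hu
      have : (h.comp (balancedMapR A I (F.d (n - 1) n)).toAddMonoidHom) v =
          (0 : BalancedTensor A I (F.X (n - 1)) →+ QZ) v := by
        apply bt_ext
        intro x y
        refine (hh x (F.d (n - 1) n y)).trans ?_
        have h1 : f (F.d (n - 1) n y) = 0 := by
          have := congrArg (fun q => q.hom y) hf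
          exact this
        change DR.ev (f (F.d (n - 1) n y)) x = 0
        rw [h1]; rfl
      exact this)
    obtain ⟨g, hg⟩ := bt_curry ψ
    refine ⟨ModuleCat.ofHom (swapRL g), ?_⟩
    ext y
    apply DR.ext'
    intro x
    refine (hg x (F.d n (n + 1) y)).trans (Eq.trans ?_ (hh x y))
    exact hψ (btmul I (F.X n) x y)
  · intro H n u hu
    refine qz_sep_sub (balancedMapR A I (F.d (n - 1) n)).toAddMonoidHom u (fun χ hχ => ?_)
    obtain ⟨f, hf⟩ := bt_curry χ
    obtain ⟨g, hg⟩ := H n (ModuleCat.ofHom (swapRL f)) (by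
      ext y
      apply DR.ext'
      intro x
      refine (hf x (F.d (n - 1) n y)).trans ?_
      exact hχ (btmul I (F.X (n - 1)) x y))
    obtain ⟨h, hh⟩ := bt_lift (swapLR g.hom)
    have : χ u = (h.comp (balancedMapR A I (F.d n (n + 1))).toAddMonoidHom) u := by
      apply bt_ext
      intro x y
      refine (hf x y).symm.trans (Eq.trans ?_ (hh x (F.d n (n + 1) y)).symm)
      have := congrArg (fun q => DR.ev (q.hom y) x) hg
      exact this.symm
    rw [this]
    change h (balancedMapR A I (F.d n (n + 1)) u) = 0
    rw [hu, map_zero]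

lemma homToAcyclic_retract (X : Cplx A) (Q R : ModuleCat.{u} A) (i : Q ⟶ R) (p : R ⟶ Q)
    (hip : i ≫ p = 𝟙 Q) (H : HomToAcyclic A X R) : HomToAcyclic A X Q := by
  intro n f hf
  obtain ⟨g, hg⟩ := H n (f ≫ i) (by rw [← Category.assoc, hf, zero_comp])
  exact ⟨g ≫ p, by rw [← Category.assoc, hg, Category.assoc, hip, Category.comp_id]⟩

end Helpers

/-- Over an Artin algebra `A` (an algebra over a commutative
artinian ring `k`, finitely generated as a `k`-module), the classes of
Gorenstein-projective and Gorenstein-flat modules coincide. -/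
theorem gorensteinProjective_iff_gorensteinFlat
    (k : Type u) [CommRing k] [IsArtinianRing k]
    [Algebra k A] [Module.Finite k A] (M : ModuleCat.{u} A) :
    IsGorensteinProjective A M ↔ IsGorensteinFlat A M := by
  have : IsNoetherianRing k := inferInstance
  have : IsArtinianRing A := IsArtinianRing.of_finite k A
  have : IsNoetherianRing Aᵐᵒᵖ := IsNoetherianRing.of_finite k Aᵐᵒᵖ
  constructor
  · rintro ⟨P, hac, hP, hQ, e⟩
    refine ⟨P, hac, fun n => ?_, fun I hI => ?_, e⟩
    · have := hP n
      exact (flat_iff _).2 (DL_injective_of_projective _)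
    · rw [tensorAcyclic_iff]
      exact hQ _ (projective_of_DL_injective _ (DLDR_injective I hI))
  · rintro ⟨F, hac, hF, hT, e⟩
    refine ⟨F, hac, fun n => projective_of_DL_injective _ ((flat_iff _).1 (hF n)),
      fun Q hQ => ?_, e⟩
    obtain ⟨s, hs⟩ := eta_split (A := A) Q
    refine homToAcyclic_retract F Q (ModuleCat.of A (DR (DL Q))) (ModuleCat.ofHom (eta Q))
      (ModuleCat.ofHom s) ?_ ?_
    · ext q
      exact LinearMap.congr_fun hs q
    · exact (tensorAcyclic_iff (ModuleCat.of Aᵐᵒᵖ (DL Q)) F).1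
        (hT _ (DL_injective_of_projective (A := A) Q))
end

section
/- Let A be an Artin algebra with dualizing module R. Then the functor R ⊗_A − maps Gorenstein-projective A-modules to Gorenstein-injective A-modules, the functor Hom_A(R,−) maps Gorenstein-injective A-modules to Gorenstein-projective A-modules, and these functors define mutually quasi-inverse equivalences between the category 𝒢𝒫(A) of Gorenstein-projective A-modules and the category 𝒢ℐ(A) of Gorenstein-injective A-modules. -/
open CategoryTheory CategoryTheory.Limits

universe u

variable (A : Type u) [Ring A]

section Bimodule

open TensorProduct

variable (R : Type u) [AddCommGroup R] [Module A R] [Module Aᵐᵒᵖ R]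
  [SMulCommClass A Aᵐᵒᵖ R]

/-- The natural map `A → Hom_A(R,R)` sending `a` to right multiplication by `a`. -/
def rightMulMap (a : A) : R →ₗ[A] R where
  toFun x := MulOpposite.op a • x
  map_add' x y := smul_add _ x y
  map_smul' r x := (smul_comm r (MulOpposite.op a) x).symm

/-- The natural map `A → Hom_{Aᵒᵖ}(R,R)` sending `a` to left multiplication by `a`. -/
def leftMulMap (a : A) : R →ₗ[Aᵐᵒᵖ] R where
  toFun x := a • x
  map_add' x y := smul_add _ x y
  map_smul' b x := (smul_comm a b x)

/-- The submodule of balancing relations in `R ⊗[ℤ] M`. -/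
def tensorRelA (M : ModuleCat.{u} A) : Submodule A (TensorProduct ℤ R M) :=
  Submodule.span A
    {z | ∃ (x : R) (a : A) (y : M),
      z = (MulOpposite.op a • x) ⊗ₜ[ℤ] y - x ⊗ₜ[ℤ] (a • y)}

/-- The left `A`-module `R ⊗[A] M`, for `R` an `(A,A)`-bimodule and `M` a left
`A`-module. -/
noncomputable def tensorObj (M : ModuleCat.{u} A) : ModuleCat.{u} A :=
  ModuleCat.of A ((TensorProduct ℤ R M) ⧸ tensorRelA A R M)

/-- The `A`-linear map `R ⊗[ℤ] M → R ⊗[ℤ] N` induced by `f : M → N`. -/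
noncomputable def tensorMapPre {M N : ModuleCat.{u} A} (f : M ⟶ N) :
    (TensorProduct ℤ R M) →ₗ[A] (TensorProduct ℤ R N) :=
  TensorProduct.AlgebraTensorModule.map (LinearMap.id : R →ₗ[A] R)
    f.hom.toAddMonoidHom.toIntLinearMap

lemma tensorMapPre_rel {M N : ModuleCat.{u} A} (f : M ⟶ N) :
    tensorRelA A R M ≤ (tensorRelA A R N).comap (tensorMapPre A R f) := by
  rw [tensorRelA, Submodule.span_le]
  rintro z ⟨x, a, y, rfl⟩
  simp only [SetLike.mem_coe, Submodule.mem_comap, map_sub, tensorMapPre,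
    TensorProduct.AlgebraTensorModule.map_tmul]
  have hf : f.hom.toAddMonoidHom.toIntLinearMap (a • y) = a • f y := f.hom.map_smul a y
  have hid : (LinearMap.id : R →ₗ[A] R) (MulOpposite.op a • x) = MulOpposite.op a • x := rfl
  rw [hf, hid]
  exact Submodule.subset_span ⟨x, a, f y, by simp⟩

/-- The functor `R ⊗[A] − : Mod(A) → Mod(A)`. -/
noncomputable def tensorFunctor : ModuleCat.{u} A ⥤ ModuleCat.{u} A where
  obj M := tensorObj A R M
  map {M N} f := ModuleCat.ofHom
    (Submodule.mapQ _ _ (tensorMapPre A R f) (tensorMapPre_rel A R f))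
  map_id M := by
    apply ModuleCat.hom_ext
    apply LinearMap.ext
    intro z
    obtain ⟨t, rfl⟩ := Submodule.Quotient.mk_surjective _ z
    show ((tensorRelA A R M).mapQ (tensorRelA A R M) (tensorMapPre A R (𝟙 M))
      (tensorMapPre_rel A R (𝟙 M))) (Submodule.Quotient.mk t) = Submodule.Quotient.mk t
    rw [Submodule.mapQ_apply]
    congr 1
    induction t using TensorProduct.induction_on with
    | zero => simp
    | tmul x y => rfl
    | add a b ha hb => rw [map_add, ha, hb]
  map_comp {M N P} f g := by
    apply ModuleCat.hom_ext
    apply LinearMap.ext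
    intro z
    obtain ⟨t, rfl⟩ := Submodule.Quotient.mk_surjective _ z
    show ((tensorRelA A R M).mapQ (tensorRelA A R P) (tensorMapPre A R (f ≫ g))
        (tensorMapPre_rel A R (f ≫ g))) (Submodule.Quotient.mk t)
      = ((tensorRelA A R N).mapQ (tensorRelA A R P) (tensorMapPre A R g)
          (tensorMapPre_rel A R g))
        (((tensorRelA A R M).mapQ (tensorRelA A R N) (tensorMapPre A R f)
          (tensorMapPre_rel A R f)) (Submodule.Quotient.mk t))
    rw [Submodule.mapQ_apply, Submodule.mapQ_apply, Submodule.mapQ_apply]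
    congr 1
    induction t using TensorProduct.induction_on with
    | zero => simp
    | tmul x y => rfl
    | add a b ha hb => rw [map_add, map_add, map_add, ha, hb]

instance : (tensorFunctor A R).Additive where
  map_add := by
    intro M N f g
    apply ModuleCat.hom_ext
    apply LinearMap.ext
    intro z
    obtain ⟨t, rfl⟩ := Submodule.Quotient.mk_surjective _ z
    show ((tensorRelA A R M).mapQ (tensorRelA A R N) (tensorMapPre A R (f + g))
        (tensorMapPre_rel A R (f + g))) (Submodule.Quotient.mk t)
      = ((tensorRelA A R M).mapQ (tensorRelA A R N) (tensorMapPre A R f)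
          (tensorMapPre_rel A R f)) (Submodule.Quotient.mk t)
        + ((tensorRelA A R M).mapQ (tensorRelA A R N) (tensorMapPre A R g)
          (tensorMapPre_rel A R g)) (Submodule.Quotient.mk t)
    rw [Submodule.mapQ_apply, Submodule.mapQ_apply, Submodule.mapQ_apply,
      ← Submodule.Quotient.mk_add]
    congr 1
    induction t using TensorProduct.induction_on with
    | zero => simp
    | tmul x y =>
        show x ⊗ₜ[ℤ] ((f + g).hom y) = x ⊗ₜ[ℤ] (f.hom y) + x ⊗ₜ[ℤ] (g.hom y)
        rw [ModuleCat.hom_add, LinearMap.add_apply, TensorProduct.tmul_add]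
    | add a b ha hb =>
        rw [map_add, map_add, map_add, ha, hb]
        abel

/-- The left `A`-module structure on `Hom_A(R, J)`, with `A` acting through the
right `A`-module structure of `R`. -/
instance homModule (J : ModuleCat.{u} A) : Module A (R →ₗ[A] J) where
  smul a f := LinearMap.comp f (rightMulMap A R a)
  one_smul f := LinearMap.ext fun x => by
    show f (MulOpposite.op (1 : A) • x) = f x
    rw [MulOpposite.op_one, one_smul]
  mul_smul a b f := LinearMap.ext fun x => by
    show f (MulOpposite.op (a * b) • x) = f (MulOpposite.op b • MulOpposite.op a • x)
    rw [smul_smul, ← MulOpposite.op_mul]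
  smul_zero a := LinearMap.ext fun _ => rfl
  smul_add a f g := LinearMap.ext fun _ => rfl
  add_smul a b f := LinearMap.ext fun x => by
    show f (MulOpposite.op (a + b) • x)
      = f (MulOpposite.op a • x) + f (MulOpposite.op b • x)
    rw [MulOpposite.op_add, add_smul, map_add]
  zero_smul f := LinearMap.ext fun x => by
    show f (MulOpposite.op (0 : A) • x) = 0
    rw [MulOpposite.op_zero, zero_smul, map_zero]

/-- The functor `Hom_A(R, −) : Mod(A) → Mod(A)`. -/
noncomputable def homFunctor : ModuleCat.{u} A ⥤ ModuleCat.{u} A where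
  obj J := ModuleCat.of A (R →ₗ[A] J)
  map {J J'} f :=
    ModuleCat.ofHom
    { toFun := fun g => LinearMap.comp (f.hom : J →ₗ[A] J') g
      map_add' := fun g h => LinearMap.ext fun x => map_add f.hom _ _
      map_smul' := fun a g => rfl }
  map_id J := ModuleCat.hom_ext <| LinearMap.ext fun g => LinearMap.ext fun x => rfl
  map_comp f g := ModuleCat.hom_ext <| LinearMap.ext fun h => LinearMap.ext fun x => rfl

instance : (homFunctor A R).Additive where
  map_add := by
    intro J J' f g
    exact ModuleCat.hom_ext <| LinearMap.ext fun h => LinearMap.ext fun x => rfl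

end Bimodule

section Statement15

variable (R : Type u) [AddCommGroup R] [Module A R] [Module Aᵐᵒᵖ R]
  [SMulCommClass A Aᵐᵒᵖ R]

/-- The lift of `R ⊗[A] −` to a functor from Gorenstein-projectives to
Gorenstein-injectives. -/
noncomputable def gpToGi
    (h1 : ∀ M : ModuleCat.{u} A, IsGorensteinProjective A M →
      IsGorensteinInjective A ((tensorFunctor A R).obj M)) :
    ObjectProperty.FullSubcategory (IsGorensteinProjective A) ⥤
      ObjectProperty.FullSubcategory (IsGorensteinInjective A) :=
  ObjectProperty.lift _
    (ObjectProperty.ι (IsGorensteinProjective A) ⋙ tensorFunctor A R)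
    (fun X => h1 X.obj X.property)

/-- The lift of `Hom_A(R, −)` to a functor from Gorenstein-injectives to
Gorenstein-projectives. -/
noncomputable def giToGp
    (h2 : ∀ J : ModuleCat.{u} A, IsGorensteinInjective A J →
      IsGorensteinProjective A ((homFunctor A R).obj J)) :
    ObjectProperty.FullSubcategory (IsGorensteinInjective A) ⥤
      ObjectProperty.FullSubcategory (IsGorensteinProjective A) :=
  ObjectProperty.lift _
    (ObjectProperty.ι (IsGorensteinInjective A) ⋙ homFunctor A R)
    (fun X => h2 X.obj X.property)


lemma exists_annih (hInjR : Module.Injective Aᵐᵒᵖ R)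
    (hBijR : Function.Bijective (leftMulMap A R)) (m : Ideal A) (hm : m.FG) (hne : m ≠ ⊤) :
    ∃ x : R, x ≠ 0 ∧ ∀ a ∈ m, a • x = 0 := by
  classical
  by_contra! hcon
  obtain ⟨n, s, hs⟩ := Submodule.fg_iff_exists_fin_generating_family.1 hm
  let φ : R →ₗ[Aᵐᵒᵖ] (Fin n → R) := LinearMap.pi fun i => leftMulMap A R (s i)
  have hφ : Function.Injective φ := by
    rw [injective_iff_map_eq_zero]
    intro x hx
    by_contra hx0
    obtain ⟨a, ha, hax⟩ := hcon x hx0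
    apply hax
    have h2 : m ≤ LinearMap.ker (LinearMap.toSpanSingleton A R x) := by
      rw [← hs, Submodule.span_le]
      rintro _ ⟨i, rfl⟩
      have := congrFun hx i
      refine LinearMap.mem_ker.2 ?_
      exact this
    simpa using h2 ha
  obtain ⟨ψ, hψ⟩ := hInjR.out φ hφ LinearMap.id
  have hb : ∀ i, ∃ b : A, leftMulMap A R b = ψ ∘ₗ LinearMap.single Aᵐᵒᵖ (fun _ : Fin n => R) i :=
    fun i => hBijR.2 _
  choose b hb using hb
  have h1 : leftMulMap A R (∑ i, b i * s i) = leftMulMap A R 1 := by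
    ext x
    have h3 := hψ x
    have h4 : φ x = ∑ i, Pi.single i (s i • x) := by
      rw [Finset.univ_sum_single]; rfl
    rw [h4, map_sum] at h3
    show (∑ i, b i * s i) • x = (1 : A) • x
    rw [one_smul, Finset.sum_smul]
    refine Eq.trans ?_ h3
    refine Finset.sum_congr rfl fun i _ => ?_
    have := LinearMap.congr_fun (hb i) (s i • x)
    rw [mul_smul]
    exact this
  have h5 := hBijR.1 h1
  apply hne
  rw [Ideal.eq_top_iff_one, ← h5]
  refine sum_mem fun i _ => m.mul_mem_left _ ?_
  rw [← hs]; exact Submodule.subset_span ⟨i, rfl⟩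

lemma simple_embed [IsNoetherianRing A] (hInjR : Module.Injective Aᵐᵒᵖ R)
    (hBijR : Function.Bijective (leftMulMap A R)) (S : Type u) [AddCommGroup S] [Module A S]
    [IsSimpleModule A S] : ∃ f : S →ₗ[A] R, Function.Injective f := by
  have := IsSimpleModule.nontrivial A S
  obtain ⟨s, hs⟩ := exists_ne (0 : S)
  have hsurj := IsSimpleModule.toSpanSingleton_surjective A hs
  obtain ⟨x, hx, hann⟩ := exists_annih A R hInjR hBijR
    (LinearMap.ker (LinearMap.toSpanSingleton A S s)) (IsNoetherian.noetherian _) (by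
      intro h
      have : (1 : A) ∈ LinearMap.ker (LinearMap.toSpanSingleton A S s) := by
        rw [h]; trivial
      apply hs
      simpa using this)
  let e := (LinearMap.toSpanSingleton A S s).quotKerEquivOfSurjective hsurj
  let g : (A ⧸ LinearMap.ker (LinearMap.toSpanSingleton A S s)) →ₗ[A] R :=
    Submodule.liftQ _ (LinearMap.toSpanSingleton A R x) (fun a ha => by
      simpa using hann a ha)
  refine ⟨g ∘ₗ e.symm.toLinearMap, ?_⟩
  refine (LinearMap.injective_or_eq_zero _).resolve_right fun h => hx ?_
  have := LinearMap.congr_fun h (e (Submodule.Quotient.mk 1))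
  simpa [g] using this

lemma finsupp_injective [IsNoetherianRing A] (hInjL : Module.Injective A R) (ι : Type u) :
    Module.Injective A (ι →₀ R) := by
  classical
  refine Module.Baer.injective fun I g => ?_
  have hB := Module.Baer.of_injective hInjL
  obtain ⟨n, s, hs⟩ := Submodule.fg_iff_exists_fin_generating_family.1
    (IsNoetherian.noetherian (⊤ : Submodule A I))
  let T : Finset ι := Finset.univ.biUnion fun i => (g (s i)).support
  have hT : ∀ y, ∀ i ∉ T, g y i = 0 := by
    intro y i hi
    have h1 : (⊤ : Submodule A I) ≤ LinearMap.ker ((Finsupp.lapply i : (ι →₀ R) →ₗ[A] R) ∘ₗ g) := by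
      rw [← hs, Submodule.span_le]
      rintro _ ⟨j, rfl⟩
      by_contra h
      apply hi
      simp only [T, Finset.mem_biUnion]
      exact ⟨j, Finset.mem_univ _, by simpa using h⟩
    simpa using h1 (Submodule.mem_top (x := y))
  choose h hh using fun i => hB I ((Finsupp.lapply i : (ι →₀ R) →ₗ[A] R) ∘ₗ g)
  let v : ι →₀ R := Finsupp.onFinset T (fun i => if i ∈ T then h i 1 else 0)
    (fun i hi => by by_contra hc; simp [hc] at hi)
  refine ⟨LinearMap.toSpanSingleton A _ v, fun x hx => ?_⟩
  ext i
  by_cases hi : i ∈ T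
  · have := hh i x hx
    simp only [LinearMap.comp_apply, Finsupp.lapply_apply] at this
    rw [← this]
    simp [v, hi, ← map_smul]
  · rw [hT _ i hi]
    simp [v, hi]

lemma embed_finsupp [IsNoetherianRing A] [IsArtinianRing A] (hInjL : Module.Injective A R)
    (hInjR : Module.Injective Aᵐᵒᵖ R)
    (hBijR : Function.Bijective (leftMulMap A R)) (M : Type u) [AddCommGroup M] [Module A M] :
    ∃ (ι : Type u) (f : M →ₗ[A] (ι →₀ R)), Function.Injective f := by
  classical
  let N : Submodule A M := sSup {m : Submodule A M | IsSimpleModule A m}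
  have : IsSemisimpleModule A N := by
    have : ∀ m ∈ {m : Submodule A M | IsSimpleModule A m}, IsSemisimpleModule A m := by
      intro m hm
      have : IsSimpleModule A m := hm
      infer_instance
    have h := isSemisimpleModule_biSup_of_isSemisimpleModule_submodule this
    rw [← sSup_eq_iSup] at h
    exact h
  obtain ⟨s, e, -, hs⟩ := IsSemisimpleModule.exists_linearEquiv_dfinsupp A N
  choose j hj using fun m : s => simple_embed A R hInjR hBijR m.1
  have := finsupp_injective A R hInjL s
  let g : N →ₗ[A] (s →₀ R) := (finsuppLequivDFinsupp A).symm.toLinearMap ∘ₗ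
    DFinsupp.mapRange.linearMap j ∘ₗ e.toLinearMap
  have hg : Function.Injective g := by
    have h0 : Function.Injective (DFinsupp.mapRange.linearMap j) :=
      (DFinsupp.mapRange_injective (fun i => j i) fun i => map_zero _).2 hj
    intro a b hab
    exact e.injective (h0 ((finsuppLequivDFinsupp A).symm.injective hab))
  obtain ⟨f, hf⟩ := this.out N.subtype N.subtype_injective g
  refine ⟨s, f, ?_⟩
  rw [← LinearMap.ker_eq_bot]
  by_contra hK
  obtain ⟨x, hx, hx0⟩ := Submodule.exists_mem_ne_zero_of_ne_bot hK
  have : Nontrivial (Submodule.span A {x}) :=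
    ⟨⟨x, Submodule.mem_span_singleton_self x⟩, 0, fun h => hx0 (congrArg Subtype.val h)⟩
  have : IsArtinian A (Submodule.span A {x}) := isArtinian_of_fg_of_artinian _ ⟨{x}, by simp⟩
  obtain ⟨m, hm⟩ := IsAtomic.exists_atom (Submodule A (Submodule.span A {x}))
  obtain ⟨y, hy, hy0⟩ := Submodule.exists_mem_ne_zero_of_ne_bot hm.1
  rw [← isSimpleModule_iff_isAtom] at hm
  have hm' : IsSimpleModule A (m.map (Submodule.span A {x}).subtype) :=
    IsSimpleModule.congr (Submodule.equivMapOfInjective _ (Submodule.subtype_injective _) m).symm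
  have hyN : (y : M) ∈ N := by
    have : m.map (Submodule.span A {x}).subtype ≤ N := le_sSup hm'
    exact this ⟨y, hy, rfl⟩
  have hfy : f y = 0 := by
    have : Submodule.span A {x} ≤ LinearMap.ker f := by
      rw [Submodule.span_le]; simpa using hx
    exact this y.2
  have h1 := hf ⟨y, hyN⟩
  have h2 : g ⟨y, hyN⟩ = 0 := by rw [← h1]; exact hfy
  have h3 := hg (h2.trans (map_zero g).symm)
  exact hy0 (Subtype.ext (show (y : M) = 0 from congrArg (fun z : N => (z : M)) h3))


section Adj
open TensorProduct

/-- The class of a pure tensor. -/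
noncomputable def tmk (M : ModuleCat.{u} A) (x : R) (y : M) : (tensorFunctor A R).obj M :=
  (Submodule.Quotient.mk (x ⊗ₜ[ℤ] y) : (TensorProduct ℤ R M) ⧸ tensorRelA A R M)

lemma tmk_map {M N : ModuleCat.{u} A} (f : M ⟶ N) (x : R) (y : M) :
    ((tensorFunctor A R).map f).hom (tmk A R M x y) = tmk A R N x (f.hom y) := rfl

lemma tmk_add_left (M : ModuleCat.{u} A) (x x' : R) (y : M) :
    tmk A R M (x + x') y = tmk A R M x y + tmk A R M x' y := by
  unfold tmk
  rw [TensorProduct.add_tmul, Submodule.Quotient.mk_add]; rfl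

lemma tmk_add_right (M : ModuleCat.{u} A) (x : R) (y y' : M) :
    tmk A R M x (y + y') = tmk A R M x y + tmk A R M x y' := by
  unfold tmk
  rw [TensorProduct.tmul_add, Submodule.Quotient.mk_add]; rfl

lemma tmk_smul_left (M : ModuleCat.{u} A) (a : A) (x : R) (y : M) :
    tmk A R M (a • x) y = a • tmk A R M x y := rfl

lemma tmk_smul (M : ModuleCat.{u} A) (a : A) (x : R) (y : M) :
    tmk A R M (MulOpposite.op a • x) y = tmk A R M x (a • y) := by
  unfold tmk
  refine (Submodule.Quotient.eq _).2 ?_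
  exact Submodule.subset_span ⟨x, a, y, rfl⟩

lemma tensor_hom_ext {M J : ModuleCat.{u} A} {f g : (tensorFunctor A R).obj M →ₗ[A] J}
    (h : ∀ x y, f (tmk A R M x y) = g (tmk A R M x y)) : f = g := by
  refine LinearMap.ext fun z => ?_
  obtain ⟨t, rfl⟩ := Submodule.Quotient.mk_surjective _ z
  induction t using TensorProduct.induction_on with
  | zero => exact (map_zero f).trans (map_zero g).symm
  | tmul x y => exact h x y
  | add a b ha hb =>
    have h1 := map_add f (Submodule.Quotient.mk a : (TensorProduct ℤ R M) ⧸ tensorRelA A R M)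
      (Submodule.Quotient.mk b : (TensorProduct ℤ R M) ⧸ tensorRelA A R M)
    have h2 := map_add g (Submodule.Quotient.mk a : (TensorProduct ℤ R M) ⧸ tensorRelA A R M)
      (Submodule.Quotient.mk b : (TensorProduct ℤ R M) ⧸ tensorRelA A R M)
    exact h1.trans ((congrArg₂ (· + ·) ha hb).trans h2.symm)

/-- Universal property of the tensor product. -/
noncomputable def tlift {M : ModuleCat.{u} A} {J : Type u} [AddCommGroup J] [Module A J]
    (φ : M → R →ₗ[A] J)
    (hadd : ∀ y y', φ (y + y') = φ y + φ y')
    (hsmul : ∀ (a : A) y x, φ (a • y) x = φ y (MulOpposite.op a • x)) :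
    (tensorFunctor A R).obj M →ₗ[A] J :=
  Submodule.liftQ (tensorRelA A R M)
    (TensorProduct.AlgebraTensorModule.lift
      { toFun := fun x => (AddMonoidHom.mk' (fun y => φ y x) (fun y y' => by
          rw [hadd]; rfl)).toIntLinearMap
        map_add' := fun x x' => by ext y; exact map_add (φ y) x x'
        map_smul' := fun a x => by ext y; exact map_smul (φ y) a x })
    (by
      rw [tensorRelA, Submodule.span_le]
      rintro _ ⟨x, a, y, rfl⟩
      refine LinearMap.mem_ker.2 ?_
      rw [map_sub, sub_eq_zero]
      exact (hsmul a y x).symm)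

lemma tlift_tmk {M : ModuleCat.{u} A} {J : Type u} [AddCommGroup J] [Module A J]
    (φ : M → R →ₗ[A] J) (hadd) (hsmul) (x : R) (y : M) :
    tlift A R φ hadd hsmul (tmk A R M x y) = φ y x := rfl

/-- unit -/
noncomputable def unitHom (M : ModuleCat.{u} A) :
    M ⟶ (homFunctor A R).obj ((tensorFunctor A R).obj M) :=
  ModuleCat.ofHom (Y := R →ₗ[A] ((tensorFunctor A R).obj M))
    { toFun := fun y =>
        { toFun := fun x => tmk A R M x y
          map_add' := fun x x' => tmk_add_left A R M x x' y
          map_smul' := fun a x => tmk_smul_left A R M a x y }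
      map_add' := fun y y' => LinearMap.ext fun x => tmk_add_right A R M x y y'
      map_smul' := fun a y => LinearMap.ext fun x => (tmk_smul A R M a x y).symm }

/-- counit -/
noncomputable def counitHom (J : ModuleCat.{u} A) :
    (tensorFunctor A R).obj ((homFunctor A R).obj J) ⟶ J :=
  ModuleCat.ofHom (tlift A R (M := (homFunctor A R).obj J) (J := J)
    (fun f => (f : R →ₗ[A] J)) (fun _ _ => rfl) (fun _ _ _ => rfl))

/-- The tensor-hom adjunction. -/
noncomputable def thAdj : tensorFunctor A R ⊣ homFunctor A R :=
  Adjunction.mkOfUnitCounit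
    { unit :=
        { app := fun M => unitHom A R M
          naturality := fun M N f => by
            refine ModuleCat.hom_ext (LinearMap.ext fun y => ?_)
            exact LinearMap.ext (M := R) (M₃ := (tensorFunctor A R).obj N) fun x => rfl }
      counit :=
        { app := fun J => counitHom A R J
          naturality := fun J K f => by
            refine ModuleCat.hom_ext (tensor_hom_ext A R fun x y => rfl) }
      left_triangle := by
        ext M : 2
        refine ModuleCat.hom_ext (tensor_hom_ext A R fun x y => rfl)
      right_triangle := by
        ext J : 2
        refine ModuleCat.hom_ext (LinearMap.ext fun y => ?_)
        exact LinearMap.ext (M := R) (M₃ := J) fun x => rfl }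

/-- `R ⊗ A^(ι) ≅ R^(ι)`. -/
noncomputable def tfree (ι : Type u) :
    (tensorFunctor A R).obj (ModuleCat.of A (ι →₀ A)) ≃ₗ[A] (ι →₀ R) := by
  classical
  refine LinearEquiv.ofLinear
    (tlift A R (M := ModuleCat.of A (ι →₀ A)) (J := ι →₀ R)
      (fun v =>
        { toFun := fun x => (v : ι →₀ A).mapRange (fun a => MulOpposite.op a • x) (by simp)
          map_add' := fun x x' => by ext i; simp
          map_smul' := fun a x => by ext i; simp [smul_comm] })
      (fun v w => by
        refine LinearMap.ext fun x => Finsupp.ext fun i => ?_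
        show MulOpposite.op ((v : ι →₀ A) i + (w : ι →₀ A) i) • x =
          MulOpposite.op ((v : ι →₀ A) i) • x + MulOpposite.op ((w : ι →₀ A) i) • x
        rw [MulOpposite.op_add, add_smul])
      (fun a v x => by
        refine Finsupp.ext fun i => ?_
        show MulOpposite.op (a * v i) • x = MulOpposite.op (v i) • MulOpposite.op a • x
        rw [MulOpposite.op_mul, mul_smul]))
    (Finsupp.lsum ℕ fun i => 
      (show R →ₗ[A] (tensorFunctor A R).obj (ModuleCat.of A (ι →₀ A)) from
        ((unitHom A R (ModuleCat.of A (ι →₀ A))).hom (Finsupp.single i 1) :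
          R →ₗ[A] (tensorFunctor A R).obj (ModuleCat.of A (ι →₀ A))))) ?_ ?_
  · refine Finsupp.lhom_ext fun i x => ?_
    rw [LinearMap.comp_apply, Finsupp.lsum_single]
    refine Finsupp.ext fun j => ?_
    show MulOpposite.op ((Finsupp.single i (1 : A) : ι →₀ A) j) • x = Finsupp.single i x j
    by_cases h : i = j
    · subst h; simp
    · simp [h]
  · refine tensor_hom_ext A R fun x v => ?_
    let v' : ι →₀ A := v
    show _ = tmk A R (ModuleCat.of A (ι →₀ A)) x v'
    have hv : v = v' := rfl
    rw [hv, LinearMap.comp_apply, tlift_tmk]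
    clear hv
    clear_value v'
    show Finsupp.lsum ℕ _ (v'.mapRange (fun a => MulOpposite.op a • x) (by simp)) = _
    induction v' using Finsupp.induction_linear with
    | zero =>
      rw [Finsupp.mapRange_zero, map_zero]
      exact (LinearMap.congr_fun (M := R)
        (map_zero (unitHom A R (ModuleCat.of A (ι →₀ A))).hom) x).symm
    | add f g hf hg =>
      rw [Finsupp.mapRange_add (fun a b => by rw [MulOpposite.op_add, add_smul]), map_add, hf, hg]
      exact (tmk_add_right A R (ModuleCat.of A (ι →₀ A)) x f g).symm
    | single i a =>
      rw [Finsupp.mapRange_single, Finsupp.lsum_single]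
      refine (tmk_smul A R (ModuleCat.of A (ι →₀ A)) a x (Finsupp.single i 1)).trans ?_
      congr 1
      exact (Finsupp.smul_single a i (1 : A)).trans (by simp)

lemma tfree_tmk (ι : Type u) (x : R) (v : ι →₀ A) (i : ι) :
    tfree A R ι (tmk A R (ModuleCat.of A (ι →₀ A)) x v) i = MulOpposite.op (v i) • x := rfl

lemma free_unit (hFinL : Module.Finite A R) 
    (hBijL : Function.Bijective (rightMulMap A R)) (ι : Type u) :
    Function.Bijective ((thAdj A R).unit.app (ModuleCat.of A (ι →₀ A))) := by
  classical
  constructor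
  · intro v w h
    refine Finsupp.ext fun i => hBijL.1 (LinearMap.ext fun x => ?_)
    have h1 := LinearMap.congr_fun (M := R) 
      (M₃ := (tensorFunctor A R).obj (ModuleCat.of A (ι →₀ A))) h x
    exact DFunLike.congr_fun (congrArg (tfree A R ι) h1) i
  · intro g
    let g' : R →ₗ[A] (ι →₀ R) := (tfree A R ι).toLinearMap ∘ₗ
      (show R →ₗ[A] (tensorFunctor A R).obj (ModuleCat.of A (ι →₀ A)) from g)
    obtain ⟨n, s, hs⟩ := Submodule.fg_iff_exists_fin_generating_family.1 hFinL.fg_top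
    let T : Finset ι := Finset.univ.biUnion fun i => (g' (s i)).support
    have hT : ∀ y, ∀ i ∉ T, g' y i = 0 := by
      intro y i hi
      have h1 : (⊤ : Submodule A R) ≤
          LinearMap.ker ((Finsupp.lapply i : (ι →₀ R) →ₗ[A] R) ∘ₗ g') := by
        rw [← hs, Submodule.span_le]
        rintro _ ⟨j, rfl⟩
        by_contra h
        apply hi
        simp only [T, Finset.mem_biUnion]
        exact ⟨j, Finset.mem_univ _, by simpa using h⟩
      simpa using h1 (Submodule.mem_top (x := y))
    choose a ha using fun i => hBijL.2 ((Finsupp.lapply i : (ι →₀ R) →ₗ[A] R) ∘ₗ g')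
    let v : ι →₀ A := Finsupp.onFinset T a (fun i hi => by
      by_contra hc
      apply hi
      apply hBijL.1
      rw [ha]
      refine LinearMap.ext fun x => (hT x i hc).trans ?_
      show _ = MulOpposite.op (0 : A) • x
      simp)
    refine ⟨v, ?_⟩
    refine LinearMap.ext (M := R) 
      (M₃ := (tensorFunctor A R).obj (ModuleCat.of A (ι →₀ A))) fun x => ?_
    apply (tfree A R ι).injective
    refine Finsupp.ext fun i => ?_
    exact LinearMap.congr_fun (ha i) x

end Adj

/-- elementwise kernel condition -/
def IsKer {M X Y : ModuleCat.{u} A} (i : M ⟶ X) (d : X ⟶ Y) : Prop :=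
  Function.Injective i ∧ (∀ m, d (i m) = 0) ∧ ∀ x, d x = 0 → ∃ m, i m = x

lemma isKer_of_iso {M X Y : ModuleCat.{u} A} (d : X ⟶ Y) (e : M ≅ kernel d) :
    ∃ i : M ⟶ X, IsKer A i d := by
  let e' := e ≪≫ ModuleCat.kernelIsoKer d
  have hb : Function.Bijective e'.hom := (ConcreteCategory.isIso_iff_bijective e'.hom).1 inferInstance
  refine ⟨e'.hom ≫ ModuleCat.ofHom (LinearMap.ker d.hom).subtype, ?_, ?_, ?_⟩
  · intro a b h
    exact hb.1 (Subtype.ext h)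
  · intro m
    exact (e'.hom m).2
  · intro x hx
    obtain ⟨m, hm⟩ := hb.2 ⟨x, hx⟩
    exact ⟨m, congrArg Subtype.val hm⟩

lemma iso_of_isKer {M X Y : ModuleCat.{u} A} (i : M ⟶ X) (d : X ⟶ Y) (h : IsKer A i d) :
    Nonempty (M ≅ kernel d) := by
  obtain ⟨h1, h2, h3⟩ := h
  have hr : LinearMap.range i.hom = LinearMap.ker d.hom := by
    ext x
    constructor
    · rintro ⟨m, rfl⟩; exact h2 m
    · intro hx; exact h3 x hx
  exact ⟨((LinearEquiv.ofInjective i.hom h1).trans (LinearEquiv.ofEq _ _ hr)).toModuleIso ≪≫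
    (ModuleCat.kernelIsoKer d).symm⟩

lemma bij_of_isKer {H K : ModuleCat.{u} A ⥤ ModuleCat.{u} A} (τ : H ⟶ K)
    {M X Y : ModuleCat.{u} A} (i : M ⟶ X) (d : X ⟶ Y)
    (hH : IsKer A (H.map i) (H.map d)) (hK : IsKer A (K.map i) (K.map d))
    (hX : IsIso (τ.app X)) (hY : IsIso (τ.app Y)) : IsIso (τ.app M) := by
  rw [ConcreteCategory.isIso_iff_bijective] at *
  have ni : ∀ m, τ.app X (H.map i m) = K.map i (τ.app M m) := fun m =>
    ConcreteCategory.congr_hom (τ.naturality i) m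
  have nd : ∀ m, τ.app Y (H.map d m) = K.map d (τ.app X m) := fun m =>
    ConcreteCategory.congr_hom (τ.naturality d) m
  constructor
  · intro a b hab
    apply hH.1
    apply hX.1
    rw [ni, ni, hab]
  · intro z
    obtain ⟨y, hy⟩ := hX.2 (K.map i z)
    have h0 : H.map d y = 0 := by
      apply hY.1
      rw [nd, hy, hK.2.1, map_zero]
    obtain ⟨m, hm⟩ := hH.2.2 y h0
    refine ⟨m, hK.1 ?_⟩
    rw [← ni, hm, hy]

lemma isIso_retract {H K : ModuleCat.{u} A ⥤ ModuleCat.{u} A} (τ : H ⟶ K)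
    {X Y : ModuleCat.{u} A} (i : X ⟶ Y) (r : Y ⟶ X) (hir : i ≫ r = 𝟙 X)
    (hY : IsIso (τ.app Y)) : IsIso (τ.app X) := by
  refine ⟨K.map i ≫ inv (τ.app Y) ≫ H.map r, ?_, ?_⟩
  · rw [← NatTrans.naturality_assoc, IsIso.hom_inv_id_assoc, ← H.map_comp, hir, H.map_id]
  · rw [Category.assoc, Category.assoc, NatTrans.naturality, IsIso.inv_hom_id_assoc, ← K.map_comp,
      hir, K.map_id]

lemma injective_retract {X Y : ModuleCat.{u} A} (i : X ⟶ Y) (r : Y ⟶ X) (hir : i ≫ r = 𝟙 X)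
    (hY : Module.Injective A Y) : Module.Injective A X := by
  refine ⟨fun U V _ _ _ _ f hf g => ?_⟩
  obtain ⟨h, hh⟩ := hY.out f hf (i.hom ∘ₗ g)
  refine ⟨r.hom ∘ₗ h, fun x => ?_⟩
  show r.hom (h (f x)) = _
  rw [hh]
  exact ConcreteCategory.congr_hom hir (g x)

lemma acyclic_iff (X : Cplx A) : IsAcyclicComplex A X ↔
    ∀ i j k : ℤ, i + 1 = j → j + 1 = k → ∀ x, X.d j k x = 0 → ∃ y, X.d i j y = x := by
  constructor
  · rintro h i j k hi hk
    have := h j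
    rw [X.exactAt_iff' i j k (by simp; omega) (by simp; omega),
      ShortComplex.moduleCat_exact_iff] at this
    exact this
  · intro h n
    rw [X.exactAt_iff' (n - 1) n (n + 1) (by simp) (by simp),
      ShortComplex.moduleCat_exact_iff]
    exact h _ _ _ (by omega) rfl

lemma acyclic_of_homTo (X : Cplx A)
    (h : ∀ E : ModuleCat.{u} A, Module.Injective A E → HomToAcyclic A X E) :
    IsAcyclicComplex A X := by
  rw [acyclic_iff]
  rintro i j k rfl rfl x hx
  let C : ModuleCat.{u} A := ModuleCat.of A (X.X (i + 1) ⧸ LinearMap.range (X.d i (i + 1)).hom)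
  let q : X.X (i + 1) ⟶ C := ModuleCat.ofHom (Submodule.mkQ _)
  have hE : Module.Injective A (Injective.under C : ModuleCat.{u} A) :=
    (Module.injective_iff_injective_object A _).2 (Injective.injective_under C)
  obtain ⟨g, hg⟩ := h _ hE (i + 1) (q ≫ Injective.ι C) (by
    obtain ⟨i', hi'⟩ : ∃ i', i + 1 - 1 = i' := ⟨_, rfl⟩
    rw [hi']
    obtain rfl : i = i' := by omega
    have : X.d i (i + 1) ≫ q = 0 := by
      refine ModuleCat.hom_ext (LinearMap.ext fun y => ?_)
      exact (Submodule.Quotient.mk_eq_zero _).2 ⟨y, rfl⟩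
    rw [← Category.assoc, this, zero_comp])
  have hι : Function.Injective (Injective.ι C) :=
    (ModuleCat.mono_iff_injective _).1 inferInstance
  have h1 : Injective.ι C (q x) = 0 := by
    have := ConcreteCategory.congr_hom hg x
    refine Eq.trans this.symm ?_
    show g.hom (X.d (i + 1) (i + 1 + 1) x) = 0
    rw [hx, map_zero]
  have h2 : q x = 0 := hι (h1.trans (map_zero _).symm)
  exact (Submodule.Quotient.mk_eq_zero _).1 h2

lemma acyclic_of_homFrom (X : Cplx A)
    (h : ∀ Q : ModuleCat.{u} A, Module.Projective A Q → HomFromAcyclic A Q X) :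
    IsAcyclicComplex A X := by
  rw [acyclic_iff]
  rintro i j k hi rfl x hx
  obtain rfl : i = j - 1 := by omega
  have hA : Module.Projective A (ModuleCat.of A A) := inferInstanceAs (Module.Projective A A)
  obtain ⟨g, hg⟩ := h (ModuleCat.of A A) hA j (ModuleCat.ofHom (LinearMap.toSpanSingleton A _ x)) (by
    refine ModuleCat.hom_ext (LinearMap.ext fun a => ?_)
    show X.d j (j + 1) (a • x) = 0
    rw [map_smul, hx, smul_zero])
  refine ⟨g (1 : A), ?_⟩
  have := ConcreteCategory.congr_hom hg (1 : A)
  refine Eq.trans this ?_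
  exact one_smul A x

lemma homFrom_of_projective (X : Cplx A) (hX : IsAcyclicComplex A X) (Q : ModuleCat.{u} A)
    (hQ : Module.Projective A Q) : HomFromAcyclic A Q X := by
  rw [acyclic_iff] at hX
  intro n f hf
  let d := (X.d (n - 1) n).hom
  obtain ⟨g, hg⟩ := Module.projective_lifting_property d.rangeRestrict
    (f.hom.codRestrict (LinearMap.range d) (fun x =>
      hX (n - 1) n (n + 1) (by omega) rfl (f.hom x) (ConcreteCategory.congr_hom hf x)))
    d.surjective_rangeRestrict
  refine ⟨ModuleCat.ofHom g, ModuleCat.hom_ext (LinearMap.ext fun x => ?_)⟩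
  exact congrArg Subtype.val (LinearMap.congr_fun hg x)

lemma homTo_of_injective (X : Cplx A) (hX : IsAcyclicComplex A X) (E : ModuleCat.{u} A)
    (hE : Module.Injective A E) : HomToAcyclic A X E := by
  rw [acyclic_iff] at hX
  intro n f hf
  let d := (X.d n (n + 1)).hom
  have hk : LinearMap.ker d ≤ LinearMap.ker f.hom := by
    intro x hx
    obtain ⟨y, rfl⟩ := hX (n - 1) n (n + 1) (by omega) rfl x hx
    exact ConcreteCategory.congr_hom hf y
  obtain ⟨g, hg⟩ := hE.out ((LinearMap.ker d).liftQ d le_rfl)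
    (LinearMap.ker_eq_bot.1 (Submodule.ker_liftQ_eq_bot _ _ _ le_rfl))
    ((LinearMap.ker d).liftQ f.hom hk)
  refine ⟨ModuleCat.ofHom g, ModuleCat.hom_ext (LinearMap.ext fun x => ?_)⟩
  exact hg (Submodule.Quotient.mk x)

section Transfer

variable {F G : ModuleCat.{u} A ⥤ ModuleCat.{u} A} [F.Additive] [G.Additive] (adj : F ⊣ G)

/-- Apply an additive functor to a complex. -/
noncomputable abbrev mapC (F : ModuleCat.{u} A ⥤ ModuleCat.{u} A) [F.Additive] (X : Cplx A) :
    Cplx A :=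
  (F.mapHomologicalComplex (ComplexShape.up ℤ)).obj X

lemma homTo_map (adj : F ⊣ G) (X : Cplx A) (E : ModuleCat.{u} A) (h : HomToAcyclic A X (G.obj E)) :
    HomToAcyclic A (mapC A F X) E := by
  intro n f hf
  change F.obj (X.X n) ⟶ E at f
  change F.map (X.d (n - 1) n) ≫ f = 0 at hf
  obtain ⟨g, hg⟩ := h n (adj.homEquiv _ _ f) (by
    rw [← adj.homEquiv_naturality_left, hf, adj.homEquiv_unit, G.map_zero, comp_zero])
  refine ⟨(adj.homEquiv _ _).symm g, ?_⟩
  change F.map (X.d n (n + 1)) ≫ _ = f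
  rw [← adj.homEquiv_naturality_left_symm, hg, Equiv.symm_apply_apply]

lemma homFrom_map (adj : F ⊣ G) (X : Cplx A) (Q : ModuleCat.{u} A)
    (h : HomFromAcyclic A (F.obj Q) X) :
    HomFromAcyclic A Q (mapC A G X) := by
  intro n f hf
  change Q ⟶ G.obj (X.X n) at f
  change f ≫ G.map (X.d n (n + 1)) = 0 at hf
  obtain ⟨g, hg⟩ := h n ((adj.homEquiv _ _).symm f) (by
    rw [← adj.homEquiv_naturality_right_symm, hf, adj.homEquiv_counit, F.map_zero, zero_comp])
  refine ⟨adj.homEquiv _ _ g, ?_⟩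
  change _ ≫ G.map (X.d (n - 1) n) = f
  rw [← adj.homEquiv_naturality_right, hg, Equiv.apply_symm_apply]

lemma homFrom_map' (adj : F ⊣ G) (X : Cplx A) (hu : ∀ n, IsIso (adj.unit.app (X.X n)))
    (E : ModuleCat.{u} A) (hc : IsIso (adj.counit.app E))
    (h : HomFromAcyclic A (G.obj E) X) :
    HomFromAcyclic A E (mapC A F X) := by
  intro n f hf
  change E ⟶ F.obj (X.X n) at f
  change f ≫ F.map (X.d n (n + 1)) = 0 at hf
  have hu' := hu n
  have hu'' := hu (n + 1)
  obtain ⟨g, hg⟩ := h n (G.map f ≫ inv (adj.unit.app (X.X n))) (by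
    have hmono : Mono (adj.unit.app (X.X (n + 1))) := IsIso.mono_of_iso _
    rw [← cancel_mono (adj.unit.app (X.X (n + 1)))]
    have := adj.unit.naturality (X.d n (n + 1))
    simp only [Functor.id_map, Functor.comp_map] at this
    simp only [Category.assoc, Functor.id_obj, zero_comp] at this ⊢
    rw [this, IsIso.inv_hom_id_assoc, ← G.map_comp, hf, G.map_zero])
  have ht : F.map (inv (adj.unit.app (X.X n))) = adj.counit.app (F.obj (X.X n)) := by
    have hepi : Epi (F.map (adj.unit.app (X.X n))) := IsIso.epi_of_iso _
    rw [← cancel_epi (F.map (adj.unit.app (X.X n))), ← F.map_comp, IsIso.hom_inv_id]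
    simp
  have hfin : (inv (adj.counit.app E) ≫ F.map g) ≫ F.map (X.d (n - 1) n) = f := by
    rw [Category.assoc, ← F.map_comp, hg, F.map_comp, ht, IsIso.inv_comp_eq]
    exact adj.counit.naturality f
  exact ⟨inv (adj.counit.app E) ≫ F.map g, hfin⟩

lemma homTo_map' (adj : F ⊣ G) (X : Cplx A) (hc : ∀ n, IsIso (adj.counit.app (X.X n)))
    (Q : ModuleCat.{u} A) (hu : IsIso (adj.unit.app Q))
    (h : HomToAcyclic A X (F.obj Q)) :
    HomToAcyclic A (mapC A G X) Q := by
  intro n f hf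
  change G.obj (X.X n) ⟶ Q at f
  change G.map (X.d (n - 1) n) ≫ f = 0 at hf
  have hc' := hc n
  have hc'' := hc (n - 1)
  obtain ⟨g, hg⟩ := h n (inv (adj.counit.app (X.X n)) ≫ F.map f) (by
    have hepi : Epi (adj.counit.app (X.X (n - 1))) := IsIso.epi_of_iso _
    rw [← cancel_epi (adj.counit.app (X.X (n - 1)))]
    have := adj.counit.naturality (X.d (n - 1) n)
    simp only [Functor.id_map, Functor.comp_map] at this
    simp only [Functor.id_obj, comp_zero] at this ⊢
    rw [← Category.assoc, ← this, Category.assoc, IsIso.hom_inv_id_assoc, ← F.map_comp, hf,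
      F.map_zero])
  have ht : G.map (inv (adj.counit.app (X.X n))) = adj.unit.app (G.obj (X.X n)) := by
    have hmono : Mono (G.map (adj.counit.app (X.X n))) := IsIso.mono_of_iso _
    rw [← cancel_mono (G.map (adj.counit.app (X.X n))), ← G.map_comp, IsIso.inv_hom_id]
    simp
  have hfin : G.map (X.d n (n + 1)) ≫ G.map g ≫ inv (adj.unit.app Q) = f := by
    rw [← Category.assoc, ← G.map_comp, hg, G.map_comp, ht, IsIso.comp_inv_eq]
    exact (adj.unit.naturality f).symm
  exact ⟨G.map g ≫ inv (adj.unit.app Q), hfin⟩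

lemma map_isKer_left (adj : F ⊣ G) (X : Cplx A) (hX : IsAcyclicComplex A X)
    (hFX : IsAcyclicComplex A (mapC A F X)) {M : ModuleCat.{u} A} (i : M ⟶ X.X 0)
    (hi : IsKer A i (X.d 0 1)) : IsKer A (F.map i) (F.map (X.d 0 1)) := by
  rw [acyclic_iff] at hX hFX
  obtain ⟨h1, h2, h3⟩ := hi
  have hF1 : ∀ x : F.obj (X.X 0), F.map (X.d 0 1) x = 0 → ∃ y, F.map (X.d (-1) 0) y = x :=
    hFX (-1) 0 1 (by norm_num) (by norm_num)
  have hF2 : ∀ x : F.obj (X.X (-1)), F.map (X.d (-1) 0) x = 0 →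
      ∃ y, F.map (X.d (-2) (-1)) y = x := hFX (-2) (-1) 0 (by norm_num) (by norm_num)
  let e := LinearEquiv.ofInjective i.hom h1
  let p : X.X (-1) ⟶ M := ModuleCat.ofHom (e.symm.toLinearMap ∘ₗ
    (X.d (-1) 0).hom.codRestrict (LinearMap.range i.hom) (fun x => h3 _ (by
      exact ConcreteCategory.congr_hom (X.d_comp_d (-1) 0 1) x)))
  have hpi : p ≫ i = X.d (-1) 0 := by
    refine ModuleCat.hom_ext (LinearMap.ext fun x => ?_)
    exact congrArg Subtype.val (e.apply_symm_apply
      ⟨(X.d (-1) 0).hom x, h3 _ (ConcreteCategory.congr_hom (X.d_comp_d (-1) 0 1) x)⟩)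
  have hdp : X.d (-2) (-1) ≫ p = 0 := by
    refine ModuleCat.hom_ext (LinearMap.ext fun x => h1 ?_)
    have h4 := ConcreteCategory.congr_hom hpi (X.d (-2) (-1) x)
    have h5 := ConcreteCategory.congr_hom (X.d_comp_d (-2) (-1) 0) x
    exact (h4.trans h5).trans (map_zero i.hom).symm
  have hpe : Epi p := by
    rw [ModuleCat.epi_iff_surjective]
    intro m
    obtain ⟨y, hy⟩ := hX (-1) 0 1 (by norm_num) (by norm_num) (i m) (h2 m)
    refine ⟨y, h1 ?_⟩
    exact (ConcreteCategory.congr_hom hpi y).trans hy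
  have hFp : Function.Surjective (F.map p) := by
    rw [← ModuleCat.epi_iff_surjective]
    have := adj.leftAdjoint_preservesColimits
    infer_instance
  have hFpi : ∀ y, F.map i (F.map p y) = F.map (X.d (-1) 0) y := by
    intro y
    rw [← hpi, F.map_comp]; rfl
  have hFdp : ∀ y, F.map p (F.map (X.d (-2) (-1)) y) = 0 := by
    intro y
    have : F.map (X.d (-2) (-1)) ≫ F.map p = 0 := by rw [← F.map_comp, hdp, F.map_zero]
    exact ConcreteCategory.congr_hom this y
  refine ⟨?_, ?_, ?_⟩
  · intro a b hab
    rw [← sub_eq_zero]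
    obtain ⟨z, hz⟩ := hFp (a - b)
    have h6 : F.map (X.d (-1) 0) z = 0 := by
      rw [← hFpi, hz, map_sub, hab, sub_self]
    obtain ⟨w, rfl⟩ := hF2 z h6
    rw [← hz, hFdp]
  · intro m
    have : F.map i ≫ F.map (X.d 0 1) = 0 := by
      rw [← F.map_comp]
      have : i ≫ X.d 0 1 = 0 := ModuleCat.hom_ext (LinearMap.ext h2)
      rw [this, F.map_zero]
    exact ConcreteCategory.congr_hom this m
  · intro x hx
    obtain ⟨y, rfl⟩ := hF1 x hx
    exact ⟨F.map p y, hFpi y⟩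

end Transfer

lemma hom_isKer {M X Y : ModuleCat.{u} A} (i : M ⟶ X) (d : X ⟶ Y) (h : IsKer A i d) :
    IsKer A ((homFunctor A R).map i) ((homFunctor A R).map d) := by
  obtain ⟨h1, h2, h3⟩ := h
  refine ⟨?_, ?_, ?_⟩
  · intro a b hab
    refine LinearMap.ext (M := R) (M₃ := M) fun x => h1 ?_
    exact LinearMap.congr_fun (M := R) (M₃ := X) hab x
  · intro m
    exact LinearMap.ext (M := R) (M₃ := Y) fun x => h2 _
  · intro f hf
    let f' : R →ₗ[A] X := f
    let e := LinearEquiv.ofInjective i.hom h1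
    have hf' : ∀ x, f' x ∈ LinearMap.range i.hom := fun x =>
      h3 _ (LinearMap.congr_fun (M := R) (M₃ := Y) hf x)
    refine ⟨(e.symm.toLinearMap ∘ₗ f'.codRestrict (LinearMap.range i.hom) hf' : R →ₗ[A] M), ?_⟩
    refine LinearMap.ext (M := R) (M₃ := X) fun x => ?_
    exact congrArg Subtype.val (e.apply_symm_apply ⟨f' x, hf' x⟩)

lemma projective_good [IsNoetherianRing A] (hInjL : Module.Injective A R)
    (hFinL : Module.Finite A R) (hBijL : Function.Bijective (rightMulMap A R))
    (P : ModuleCat.{u} A) (hP : Module.Projective A P) :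
    Module.Injective A ((tensorFunctor A R).obj P) ∧ IsIso ((thAdj A R).unit.app P) := by
  obtain ⟨s, hs⟩ := hP.out
  let i : P ⟶ ModuleCat.of A (P →₀ A) := ModuleCat.ofHom s
  let r : ModuleCat.of A (P →₀ A) ⟶ P := ModuleCat.ofHom (Finsupp.linearCombination A id)
  have hir : i ≫ r = 𝟙 P := ModuleCat.hom_ext (LinearMap.ext hs)
  constructor
  · refine injective_retract A ((tensorFunctor A R).map i ≫ (tfree A R P).toModuleIso.hom)
      ((tfree A R P).toModuleIso.inv ≫ (tensorFunctor A R).map r) ?_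
      (finsupp_injective A R hInjL P)
    rw [Category.assoc, Iso.hom_inv_id_assoc, ← Functor.map_comp, hir, CategoryTheory.Functor.map_id]
  · refine isIso_retract A _ i r hir ?_
    rw [ConcreteCategory.isIso_iff_bijective]
    exact free_unit A R hFinL hBijL P

lemma injective_good [IsNoetherianRing A] [IsArtinianRing A] (hInjL : Module.Injective A R)
    (hInjR : Module.Injective Aᵐᵒᵖ R)
    (hFinL : Module.Finite A R) (hBijL : Function.Bijective (rightMulMap A R))
    (hBijR : Function.Bijective (leftMulMap A R))
    (I : ModuleCat.{u} A) (hI : Module.Injective A I) :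
    Module.Projective A ((homFunctor A R).obj I) ∧ IsIso ((thAdj A R).counit.app I) := by
  obtain ⟨ι, f, hf⟩ := embed_finsupp A R hInjL hInjR hBijR I
  obtain ⟨g, hg⟩ := hI.out f hf LinearMap.id
  let L : ModuleCat.{u} A := ModuleCat.of A (ι →₀ A)
  have hL : Module.Projective A L := inferInstanceAs (Module.Projective A (ι →₀ A))
  let e := (tfree A R ι).toModuleIso
  let i : I ⟶ (tensorFunctor A R).obj L := ModuleCat.ofHom f ≫ e.inv
  let r : (tensorFunctor A R).obj L ⟶ I := e.hom ≫ ModuleCat.ofHom g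
  have hir : i ≫ r = 𝟙 I := by
    simp only [i, r, Category.assoc, Iso.inv_hom_id_assoc]
    exact ModuleCat.hom_ext (LinearMap.ext hg)
  have hu := (projective_good A R hInjL hFinL hBijL L hL).2
  constructor
  · let i' := (homFunctor A R).map i ≫ inv ((thAdj A R).unit.app L)
    let r' := (thAdj A R).unit.app L ≫ (homFunctor A R).map r
    have h' : i' ≫ r' = 𝟙 _ := by
      simp only [i', r', Category.assoc, IsIso.inv_hom_id_assoc]
      rw [← Functor.map_comp, hir, CategoryTheory.Functor.map_id]
    have : Module.Projective A ((𝟭 (ModuleCat.{u} A)).obj L) := hL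
    exact Module.Projective.of_split i'.hom r'.hom (congrArg ModuleCat.Hom.hom h')
  · refine isIso_retract A _ i r hir ?_
    have h1 := (thAdj A R).left_triangle_components L
    have : (thAdj A R).counit.app ((tensorFunctor A R).obj L) =
        inv ((tensorFunctor A R).map ((thAdj A R).unit.app L)) := by
      rw [IsIso.eq_inv_of_hom_inv_id h1]
    rw [this]
    infer_instance

/-- Let `A` be an Artin algebra with dualizing module `R`.
Then `R ⊗[A] −` maps Gorenstein-projectives to Gorenstein-injectives,
`Hom_A(R, −)` maps Gorenstein-injectives to Gorenstein-projectives, and these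
functors are mutually quasi-inverse equivalences `𝒢𝒫(A) ≌ 𝒢ℐ(A)`. -/
theorem dualizing_module_equivalence_GP_GI
    (k : Type u) [CommRing k] [IsArtinianRing k]
    [Algebra k A] [Module.Finite k A]
    (hInjL : Module.Injective A R) (hInjR : Module.Injective Aᵐᵒᵖ R)
    (hFinL : Module.Finite A R) (hFinR : Module.Finite Aᵐᵒᵖ R)
    (hBijL : Function.Bijective (rightMulMap A R))
    (hBijR : Function.Bijective (leftMulMap A R)) :
    ∃ (h1 : ∀ M : ModuleCat.{u} A, IsGorensteinProjective A M →
        IsGorensteinInjective A ((tensorFunctor A R).obj M))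
      (h2 : ∀ J : ModuleCat.{u} A, IsGorensteinInjective A J →
        IsGorensteinProjective A ((homFunctor A R).obj J)),
      Nonempty (gpToGi A R h1 ⋙ giToGp A R h2 ≅
        𝟭 (ObjectProperty.FullSubcategory (IsGorensteinProjective A))) ∧
      Nonempty (giToGp A R h2 ⋙ gpToGi A R h1 ≅
        𝟭 (ObjectProperty.FullSubcategory (IsGorensteinInjective A))) := by
  have hArt : IsArtinianRing A := IsArtinianRing.of_finite k A
  have hNoe : IsNoetherianRing A := IsNoetherianRing.of_finite k A
  have hP := projective_good A R hInjL hFinL hBijL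
  have hI := injective_good A R hInjL hInjR hFinL hBijL hBijR
  let adj := thAdj A R
  -- complexes
  have cP : ∀ P : Cplx A, (∀ n : ℤ, Module.Projective A (P.X n)) →
      (∀ Q : ModuleCat.{u} A, Module.Projective A Q → HomToAcyclic A P Q) →
      IsAcyclicComplex A (mapC A (tensorFunctor A R) P) := fun P _ hQ =>
    acyclic_of_homTo A _ fun E hE => homTo_map A adj P E (hQ _ (hI E hE).1)
  have cI : ∀ I : Cplx A, (∀ n : ℤ, Module.Injective A (I.X n)) →
      (∀ E : ModuleCat.{u} A, Module.Injective A E → HomFromAcyclic A E I) →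
      IsAcyclicComplex A (mapC A (homFunctor A R) I) := fun I _ hE =>
    acyclic_of_homFrom A _ fun Q hQ => homFrom_map A adj I Q (hE _ (hP Q hQ).1)
  have cI' : ∀ I : Cplx A, IsAcyclicComplex A I → (∀ n : ℤ, Module.Injective A (I.X n)) →
      ∀ Q : ModuleCat.{u} A, Module.Projective A Q →
        HomToAcyclic A (mapC A (homFunctor A R) I) Q := fun I hac hinj Q hQ =>
    homTo_map' A adj I (fun n => (hI _ (hinj n)).2) Q (hP Q hQ).2
      (homTo_of_injective A I hac _ (hP Q hQ).1)
  have cP' : ∀ P : Cplx A, IsAcyclicComplex A P → (∀ n : ℤ, Module.Projective A (P.X n)) →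
      ∀ E : ModuleCat.{u} A, Module.Injective A E →
        HomFromAcyclic A E (mapC A (tensorFunctor A R) P) := fun P hac hproj E hE =>
    homFrom_map' A adj P (fun n => (hP _ (hproj n)).2) E (hI E hE).2
      (homFrom_of_projective A P hac _ (hI E hE).1)
  have h1 : ∀ M : ModuleCat.{u} A, IsGorensteinProjective A M →
        IsGorensteinInjective A ((tensorFunctor A R).obj M) := by
    rintro M ⟨P, hac, hproj, hQ, ⟨e⟩⟩
    obtain ⟨i, hi⟩ := isKer_of_iso A _ e
    exact ⟨mapC A (tensorFunctor A R) P, cP P hproj hQ, fun n => (hP _ (hproj n)).1,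
      cP' P hac hproj, iso_of_isKer A _ _ (map_isKer_left A adj P hac (cP P hproj hQ) i hi)⟩
  have h2 : ∀ J : ModuleCat.{u} A, IsGorensteinInjective A J →
        IsGorensteinProjective A ((homFunctor A R).obj J) := by
    rintro J ⟨I, hac, hinj, hE, ⟨e⟩⟩
    obtain ⟨i, hi⟩ := isKer_of_iso A _ e
    exact ⟨mapC A (homFunctor A R) I, cI I hinj hE, fun n => (hI _ (hinj n)).1,
      cI' I hac hinj, iso_of_isKer A _ _ (hom_isKer A R i _ hi)⟩
  have hunit : ∀ M : ModuleCat.{u} A, IsGorensteinProjective A M → IsIso (adj.unit.app M) := by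
    rintro M ⟨P, hac, hproj, hQ, ⟨e⟩⟩
    obtain ⟨i, hi⟩ := isKer_of_iso A _ e
    exact bij_of_isKer A adj.unit i (P.d 0 1) hi
      (hom_isKer A R _ _ (map_isKer_left A adj P hac (cP P hproj hQ) i hi))
      (hP _ (hproj 0)).2 (hP _ (hproj 1)).2
  have hcounit : ∀ J : ModuleCat.{u} A, IsGorensteinInjective A J →
      IsIso (adj.counit.app J) := by
    rintro J ⟨I, hac, hinj, hE, ⟨e⟩⟩
    obtain ⟨i, hi⟩ := isKer_of_iso A _ e
    refine bij_of_isKer A adj.counit i (I.d 0 1) ?_ hi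
      (hI _ (hinj 0)).2 (hI _ (hinj 1)).2
    exact map_isKer_left A adj (mapC A (homFunctor A R) I) (cI I hinj hE)
      (cP _ (fun n => (hI _ (hinj n)).1) (cI' I hac hinj)) _ (hom_isKer A R i _ hi)
  refine ⟨h1, h2, ⟨?_⟩, ⟨?_⟩⟩
  · refine (NatIso.ofComponents (fun X => ObjectProperty.isoMk _
      (@asIso _ _ _ _ (adj.unit.app X.obj) (hunit X.obj X.property))) ?_).symm
    intro X Y f
    apply ObjectProperty.hom_ext
    exact adj.unit.naturality f.hom
  · refine NatIso.ofComponents (fun X => ObjectProperty.isoMk _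
      (@asIso _ _ _ _ (adj.counit.app X.obj) (hcounit X.obj X.property))) ?_
    intro X Y f
    apply ObjectProperty.hom_ext
    exact adj.counit.naturality f.hom

end Statement15
end
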